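/- arXiv:1609.08914 — 6 statements merged into one kernel-verified Lean document; each statement's English description precedes it below -/
import Mathlib

section
/- Let a : ℤ → ℝ be a sequence such that the Toeplitz matrix T(a) is totally nonnegative. If a_k = 0 and a_{k+1} ≠ 0 for some k ∈ ℤ, then a_{k−n} = 0 for every integer n ≥ 1; and if a_k = 0 and a_{k−1} ≠ 0 for some k ∈ ℤ, then a_{k+n} = 0 for every integer n ≥ 1. -/
/-- A doubly infinite real matrix is totally nonnegative if all its minors
(with rows and columns selected in increasing order) are nonnegative. -/
def TotallyNonneg (M : ℤ → ℤ → ℝ) : Prop :=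
  ∀ (k : ℕ) (i j : Fin k → ℤ), StrictMono i → StrictMono j →
    0 ≤ (Matrix.of fun r s => M (i r) (j s)).det

/-- The doubly infinite Toeplitz matrix of a sequence `a : ℤ → ℝ`. -/
def toeplitz (a : ℤ → ℝ) : ℤ → ℤ → ℝ := fun i j => a (j - i)

theorem TotallyNonneg.nonneg {M : ℤ → ℤ → ℝ} (h : TotallyNonneg M) (i j : ℤ) : 0 ≤ M i j := by
  simpa using h 1 (fun _ => i) (fun _ => j) (Subsingleton.strictMono _) (Subsingleton.strictMono _)

theorem TotallyNonneg.mul_le_mul {M : ℤ → ℤ → ℝ} (h : TotallyNonneg M) {i i' j j' : ℤ}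
    (hi : i < i') (hj : j < j') : M i j' * M i' j ≤ M i j * M i' j' := by
  have := h 2 ![i, i'] ![j, j'] (by simpa [Fin.strictMono_iff_lt_succ] using hi)
    (by simpa [Fin.strictMono_iff_lt_succ] using hj)
  simpa [Matrix.det_fin_two] using this

/-- If `a` vanishes at `k`, then `a` cannot be nonzero on both sides of `k`. -/
theorem mul_eq_zero_of_totallyNonneg_toeplitz {a : ℤ → ℝ} (h : TotallyNonneg (toeplitz a))
    {k d e : ℤ} (hk : a k = 0) (hd : 0 < d) (he : 0 < e) : a (k + e) * a (k - d) = 0 := by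
  have nonneg (m : ℤ) : 0 ≤ a m := by simpa [toeplitz] using h.nonneg 0 m
  have minor := h.mul_le_mul (j := k) hd (lt_add_of_pos_right k he)
  simp only [toeplitz, sub_zero, hk, zero_mul] at minor
  exact le_antisymm minor (mul_nonneg (nonneg _) (nonneg _))

theorem stmt0 (a : ℤ → ℝ) (h : TotallyNonneg (toeplitz a)) :
    (∀ k : ℤ, a k = 0 → a (k + 1) ≠ 0 → ∀ n : ℤ, 1 ≤ n → a (k - n) = 0) ∧
    (∀ k : ℤ, a k = 0 → a (k - 1) ≠ 0 → ∀ n : ℤ, 1 ≤ n → a (k + n) = 0) := by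
  refine ⟨fun k hk hne n hn => ?_, fun k hk hne n hn => ?_⟩
  · exact (mul_eq_zero.mp
      (mul_eq_zero_of_totallyNonneg_toeplitz h hk (by lia) one_pos)).resolve_left hne
  · exact (mul_eq_zero.mp
      (mul_eq_zero_of_totallyNonneg_toeplitz h hk one_pos (by lia))).resolve_right hne
end

section
/- Let a, b : ℤ → ℝ be such that a_k = 0 for all k > n and a_n ≠ 0 for some n ∈ ℤ, b is not identically zero, and the Hurwitz-type matrix H(a,b) is totally nonnegative. Suppose a_{k−1}·b_k = a_k·b_{k−1} ≠ 0 for some k < n. If for every complex z ≠ 0 the family (a_m z^m)_{m∈ℤ} is summable, or for every complex z ≠ 0 the family (b_m z^m)_{m∈ℤ} is summable (i.e., at least one of the Laurent series converges to a function holomorphic on ℂ ∖ {0}), then a_n · b_m = b_n · a_m for every m ∈ ℤ, i.e. the two series are proportional: p(z) = (a_n/b_n)·q(z). -/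
/-- The doubly infinite Hurwitz-type matrix of two sequences `a b : ℤ → ℝ`:
row `2m` is `j ↦ a (j - m)` and row `2m+1` is `j ↦ b (j - m)`. -/
def hurwitz (a b : ℤ → ℝ) : ℤ → ℤ → ℝ :=
  fun i j => if 2 ∣ i then a (j - i / 2) else b (j - (i - 1) / 2)

theorem TotallyNonneg.entry_nonneg {M : ℤ → ℤ → ℝ} (hM : TotallyNonneg M) (i j : ℤ) :
    0 ≤ M i j := by
  have h := hM 1 ![i] ![j] (Subsingleton.strictMono _) (Subsingleton.strictMono _)
  simpa using h

theorem TotallyNonneg.minor_two_nonneg {M : ℤ → ℤ → ℝ} (hM : TotallyNonneg M)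
    {i₀ i₁ j₀ j₁ : ℤ} (hi : i₀ < i₁) (hj : j₀ < j₁) :
    0 ≤ M i₀ j₀ * M i₁ j₁ - M i₀ j₁ * M i₁ j₀ := by
  have h := hM 2 ![i₀, i₁] ![j₀, j₁] (by simpa [Fin.strictMono_iff_lt_succ] using hi)
    (by simpa [Fin.strictMono_iff_lt_succ] using hj)
  simpa [Matrix.det_fin_two] using h

theorem TotallyNonneg.minor_three_nonneg {M : ℤ → ℤ → ℝ} (hM : TotallyNonneg M)
    {i₀ i₁ i₂ j₀ j₁ j₂ : ℤ} (hi : i₀ < i₁) (hi' : i₁ < i₂) (hj : j₀ < j₁) (hj' : j₁ < j₂) :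
    0 ≤ M i₀ j₀ * M i₁ j₁ * M i₂ j₂ - M i₀ j₀ * M i₁ j₂ * M i₂ j₁
      - M i₀ j₁ * M i₁ j₀ * M i₂ j₂ + M i₀ j₁ * M i₁ j₂ * M i₂ j₀
      + M i₀ j₂ * M i₁ j₀ * M i₂ j₁ - M i₀ j₂ * M i₁ j₁ * M i₂ j₀ := by
  have h := hM 3 ![i₀, i₁, i₂] ![j₀, j₁, j₂]
    (by simp [Fin.strictMono_iff_lt_succ, Fin.forall_fin_two, hi, hi'])
    (by simp [Fin.strictMono_iff_lt_succ, Fin.forall_fin_two, hj, hj'])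
  simpa [Matrix.det_fin_three] using h

theorem hurwitz_two_mul (a b : ℤ → ℝ) (m j : ℤ) : hurwitz a b (2 * m) j = a (j - m) := by
  simp [hurwitz]

theorem hurwitz_two_mul_add_one (a b : ℤ → ℝ) (m j : ℤ) :
    hurwitz a b (2 * m + 1) j = b (j - m) := by
  have h : ¬ (2 : ℤ) ∣ 2 * m + 1 := by omega
  simp [hurwitz, h]

/-- If rows `i₀ < i₁` of a totally nonnegative matrix are proportional on columns `j₀ < j₁`, then
either they stay proportional on a later column, or every later row is proportional to row `i₀`
on the columns `j₀, j₁`. -/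
theorem TotallyNonneg.right_propagation {M : ℤ → ℤ → ℝ} (hM : TotallyNonneg M)
    {i₀ i₁ i j₀ j₁ j : ℤ} (hi : i₀ < i₁) (hi' : i₁ < i) (hj : j₀ < j₁) (hj' : j₁ < j)
    (hpos : 0 < M i₀ j₁) (hprop : M i₀ j₀ * M i₁ j₁ = M i₀ j₁ * M i₁ j₀)
    (hne : M i₀ j₁ * M i₁ j ≠ M i₁ j₁ * M i₀ j) :
    M i₀ j₀ * M i j₁ = M i₀ j₁ * M i j₀ := by
  have h3 := mul_nonneg hpos.le (hM.minor_three_nonneg hi hi' hj hj')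
  have hd := hM.minor_two_nonneg hi hj'
  have hx := hM.minor_two_nonneg (hi.trans hi') hj
  have hd' : 0 < M i₀ j₁ * M i₁ j - M i₀ j * M i₁ j₁ :=
    lt_of_le_of_ne hd fun h => hne (by linear_combination -h)
  have key : 0 ≤ -((M i₀ j₁ * M i₁ j - M i₀ j * M i₁ j₁) *
      (M i₀ j₀ * M i j₁ - M i₀ j₁ * M i j₀)) := by
    refine h3.trans_eq ?_
    linear_combination (M i₀ j₁ * M i j - M i₀ j * M i j₁) * hprop
  nlinarith [mul_nonneg hd hx]

/-- If rows `i₀ < i₁` of a totally nonnegative matrix are proportional on columns `j₀ < j₁`, then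
either they stay proportional on an earlier column, or every earlier row is proportional to row
`i₀` on the columns `j₀, j₁`. -/
theorem TotallyNonneg.left_propagation {M : ℤ → ℤ → ℝ} (hM : TotallyNonneg M)
    {i₀ i₁ i j₀ j₁ j : ℤ} (hi : i₀ < i₁) (hi' : i < i₀) (hj : j₀ < j₁) (hj' : j < j₀)
    (hpos : 0 < M i₀ j₁) (hprop : M i₀ j₀ * M i₁ j₁ = M i₀ j₁ * M i₁ j₀)
    (hne : M i₀ j₁ * M i₁ j ≠ M i₁ j₁ * M i₀ j) :
    M i j₀ * M i₀ j₁ = M i j₁ * M i₀ j₀ := by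
  have h3 := mul_nonneg hpos.le (hM.minor_three_nonneg hi' hi hj' hj)
  have hd := hM.minor_two_nonneg hi (hj'.trans hj)
  have hx := hM.minor_two_nonneg hi' hj
  have hd' : 0 < M i₀ j * M i₁ j₁ - M i₀ j₁ * M i₁ j :=
    lt_of_le_of_ne hd fun h => hne (by linear_combination h)
  have key : 0 ≤ -((M i₀ j * M i₁ j₁ - M i₀ j₁ * M i₁ j) *
      (M i j₀ * M i₀ j₁ - M i j₁ * M i₀ j₀)) := by
    refine h3.trans_eq ?_
    linear_combination (M i j * M i₀ j₁ - M i j₁ * M i₀ j) * hprop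
  nlinarith [mul_nonneg hd hx]

theorem not_summable_zpow_of_geometric_left {c : ℤ → ℝ} {s : ℝ} (hs : s ≠ 0) {p : ℤ}
    (hp : c p ≠ 0) (h : ∀ i ≤ p, c (i - 1) = s * c i) :
    ¬ Summable (fun m : ℤ => (c m : ℂ) * (s : ℂ) ^ m) := by
  intro hsum
  have hs' : (s : ℂ) ≠ 0 := by exact_mod_cast hs
  have hinj : Function.Injective fun m : ℕ => p - (m : ℤ) := fun x y hxy => by
    simpa using hxy
  have hconst : ∀ m : ℕ, (c (p - m) : ℂ) * (s : ℂ) ^ (p - (m : ℤ)) = c p * (s : ℂ) ^ p := by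
    intro m
    induction m with
    | zero => simp
    | succ m ih =>
      rw [← ih, Nat.cast_succ, ← sub_sub, h (p - m) (by omega), zpow_sub_one₀ hs']
      push_cast
      field_simp
  have hsum' := hsum.comp_injective hinj
  simp only [Function.comp_def, hconst, summable_const_iff] at hsum'
  exact mul_ne_zero (by exact_mod_cast hp) (zpow_ne_zero p hs') hsum'

theorem stmt4 (a b : ℤ → ℝ) (n : ℤ)
    (htop : ∀ k : ℤ, n < k → a k = 0) (han : a n ≠ 0)
    (hb : ∃ m, b m ≠ 0)
    (hH : TotallyNonneg (hurwitz a b))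
    (k : ℤ) (hk : k < n)
    (h1 : a (k - 1) * b k = a k * b (k - 1)) (h2 : a k * b (k - 1) ≠ 0)
    (hconv : (∀ z : ℂ, z ≠ 0 → Summable (fun m : ℤ => (a m : ℂ) * z ^ m)) ∨
             (∀ z : ℂ, z ≠ 0 → Summable (fun m : ℤ => (b m : ℂ) * z ^ m))) :
    ∀ m : ℤ, a n * b m = b n * a m := by
  have h3 : a (k - 1) * b k ≠ 0 := h1 ▸ h2
  have ev (m j : ℤ) := hurwitz_two_mul a b m j
  have od (m j : ℤ) := hurwitz_two_mul_add_one a b m j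
  have hann (j : ℤ) : 0 ≤ a j := by
    simpa only [ev, sub_zero] using hH.entry_nonneg (2 * 0) j
  have hak : 0 < a k := (hann k).lt_of_ne' (left_ne_zero_of_mul h2)
  have hak' : a (k - 1) ≠ 0 := left_ne_zero_of_mul h3
  have hprop : hurwitz a b (2 * 0) (k - 1) * hurwitz a b (2 * 0 + 1) k =
      hurwitz a b (2 * 0) k * hurwitz a b (2 * 0 + 1) (k - 1) := by
    simpa only [ev, od, sub_zero] using h1
  have hpos : 0 < hurwitz a b (2 * 0) k := by simpa only [ev, sub_zero] using hak
  have hright (j : ℤ) (hj : k < j) : a k * b j = b k * a j := by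
    by_contra hne
    have hrow (i : ℤ) (hi : 2 * 0 + 1 < i) := hH.right_propagation (by omega) hi
      (sub_one_lt k) hj hpos hprop (by simpa only [ev, od, sub_zero] using hne)
    have hgeom (c : ℤ → ℝ) (hc : c (k - 1) ≠ 0)
        (hc' : ∀ m : ℤ, 1 ≤ m → a (k - 1) * c (k - m) = a k * c (k - 1 - m)) :=
      not_summable_zpow_of_geometric_left (div_ne_zero hak' hak.ne') hc fun i hi => by
        have := hc' (k - i) (by omega)
        rw [sub_sub_cancel, show k - 1 - (k - i) = i - 1 by ring] at this
        field_simp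
        linear_combination -this
    have hz : ((a (k - 1) / a k : ℝ) : ℂ) ≠ 0 := by
      exact_mod_cast div_ne_zero hak' hak.ne'
    rcases hconv with hconv | hconv
    · refine hgeom a hak' (fun m hm => ?_) (hconv _ hz)
      simpa only [ev, sub_zero] using hrow (2 * m) (by omega)
    · refine hgeom b (right_ne_zero_of_mul h2) (fun m hm => ?_) (hconv _ hz)
      simpa only [ev, od, sub_zero] using hrow (2 * m + 1) (by omega)
  have hleft (j : ℤ) (hj : j < k - 1) : a k * b j = b k * a j := by
    by_contra hne
    have h := hH.left_propagation (i := 2 * (k - (n + 1))) (by omega) (by omega)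
      (sub_one_lt k) hj hpos hprop (by simpa only [ev, od, sub_zero] using hne)
    rw [ev, ev, ev, ev, show k - 1 - (k - (n + 1)) = n by ring,
      show k - (k - (n + 1)) = n + 1 by ring, htop (n + 1) (by omega), zero_mul, sub_zero] at h
    exact mul_ne_zero han hak.ne' h
  have hall (j : ℤ) : a k * b j = b k * a j := by
    rcases lt_trichotomy j k with hj | rfl | hj
    · rcases (Int.le_sub_one_of_lt hj).lt_or_eq with hj | rfl
      · exact hleft j hj
      · linear_combination -h1
    · ring
    · exact hright j hj
  intro m
  apply mul_left_cancel₀ hak.ne'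
  linear_combination a n * hall m - a m * hall n
end

section
/- Let a, b : ℤ → ℝ, neither identically zero, with the Hurwitz-type matrix H(a,b) totally nonnegative. Suppose there exists K ∈ ℤ with a_k > 0 for all k ≥ K, and that a_k / a_{k+1} → R as k → +∞ for some finite real R > 0 (so R < ∞ is the outer radius of convergence of the Laurent series). Define a′_k = a_k − a_{k−1}/R and b′_k = b_k − b_{k−1}/R for k ∈ ℤ (the coefficient sequences of (1 − z/R)p(z) and (1 − z/R)q(z)). Then the Hurwitz-type matrix H(a′, b′) is totally nonnegative. -/
open Matrix in
/-- If `x` is a vector to be inserted between the adjacent columns `t` and `t + 1` of `A`, and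
merging `x` with either neighbour gives a nonnegative determinant, then so does omitting `x`,
provided that the maximal proper minors involved are nonnegative. -/
theorem det_nonneg_of_merge_nonneg {k : ℕ} (A : Matrix (Fin (k + 1)) (Fin (k + 1)) ℝ)
    (x : Fin (k + 1) → ℝ) (t : Fin k)
    (hleft : 0 ≤ (A.updateCol t.castSucc ((fun r => A r t.castSucc) + x)).det)
    (hright : 0 ≤ (A.updateCol t.succ ((fun r => A r t.succ) + x)).det)
    (hB : ∀ ρ : Fin (k + 1), 0 ≤ (A.submatrix ρ.succAbove t.succ.succAbove).det)
    (hC : ∀ ρ : Fin (k + 1), 0 ≤ (A.submatrix ρ.succAbove t.castSucc.succAbove).det)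
    (hX : ∀ ρ : Fin (k + 1), 0 ≤
      ((A.submatrix ρ.succAbove t.succ.succAbove).updateCol t (fun r => x (ρ.succAbove r))).det) :
    0 ≤ A.det := by
  by_contra! hneg
  rw [det_updateCol_add, updateCol_eq_self] at hleft hright
  have hα : 0 < cramer A x t.castSucc := by rw [cramer_apply]; linarith
  have hβ : 0 < cramer A x t.succ := by rw [cramer_apply]; linarith
  have key : ∀ ρ : Fin (k + 1), (A.submatrix ρ.succAbove t.succ.succAbove).det = 0 := by
    intro ρ
    set B := A.submatrix ρ.succAbove t.succ.succAbove with hBdef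
    have hx : A.det • (fun r => x (ρ.succAbove r)) =
        ∑ j, cramer A x j • (fun r => A (ρ.succAbove r) j) := by
      funext r
      have h := congrFun (mulVec_cramer A x) (ρ.succAbove r)
      simp only [mulVec, dotProduct, Pi.smul_apply] at h
      simp only [Pi.smul_apply, Finset.sum_apply, ← h, smul_eq_mul]
      exact Finset.sum_congr rfl fun j _ => mul_comm _ _
    have hdet := congrArg (fun v => cramer B v t) hx
    simp only [map_smul, map_sum, Finset.sum_apply, Pi.smul_apply, smul_eq_mul] at hdet
    have hterm : ∀ s : Fin k, s ≠ t →
        cramer B (fun r => A (ρ.succAbove r) (t.succ.succAbove s)) t = 0 := by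
      intro s hs
      rw [cramer_apply]
      refine det_zero_of_column_eq hs fun r => ?_
      simp [hs, hBdef]
    rw [Fin.sum_univ_succAbove _ t.succ, Finset.sum_eq_single t] at hdet
    · have e1 : t.succ.succAbove t = t.castSucc := Fin.succAbove_succ_self t
      have e2 : cramer B (fun r => A (ρ.succAbove r) t.castSucc) t = B.det := by
        rw [cramer_apply, ← e1]
        exact congrArg det (updateCol_eq_self B t)
      have e3 : cramer B (fun r => A (ρ.succAbove r) t.succ) t =
          (A.submatrix ρ.succAbove t.castSucc.succAbove).det := by
        rw [cramer_apply]
        congr 1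
        ext r s
        rw [updateCol_apply]
        split_ifs with hs
        · subst hs
          simp
        · rw [hBdef, submatrix_apply, submatrix_apply]
          congr 1
          rcases lt_or_gt_of_ne hs with h | h
          · rw [Fin.succAbove_of_castSucc_lt, Fin.succAbove_of_castSucc_lt]
            · exact h
            · exact lt_trans h t.castSucc_lt_succ
          · rw [Fin.succAbove_of_lt_succ, Fin.succAbove_of_lt_succ]
            · exact lt_trans h s.castSucc_lt_succ
            · simpa using h
      rw [e1, e2, e3, cramer_apply] at hdet
      have h1 := mul_nonneg hβ.le (hC ρ)
      have h2 := mul_nonneg (neg_nonneg.2 hneg.le) (hX ρ)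
      have h3 := mul_nonneg hα.le (hB ρ)
      have h4 : cramer A x t.castSucc * B.det = 0 := by linarith
      exact (mul_eq_zero.1 h4).resolve_left hα.ne'
    · intro s _ hs
      rw [hterm s hs, mul_zero]
    · simp
  rw [det_succ_column A t.succ] at hneg
  simp [key] at hneg

/-- If the minors of column differences over adjacent intervals are nonnegative, then so are those
over arbitrary interlaced intervals `p s < q s`. -/
theorem det_interval_sub_nonneg (M : ℤ → ℤ → ℝ)
    (hM : ∀ (k : ℕ) (i : Fin k → ℤ) (c : Fin (k + 1) → ℤ), StrictMono i → StrictMono c →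
      0 ≤ (Matrix.of fun r s => M (i r) (c s.succ) - M (i r) (c s.castSucc)).det)
    (k : ℕ) (i p q : Fin k → ℤ) (hi : StrictMono i) (hpq : ∀ s, p s < q s)
    (hqp : ∀ s s', s < s' → q s ≤ p s') :
    0 ≤ (Matrix.of fun r s => M (i r) (q s) - M (i r) (p s)).det := by
  induction k with
  | zero => simp
  | succ k ih =>
    induction hN : ∑ t : Fin k, (p t.succ - q t.castSucc).toNat using Nat.strong_induction_on
      generalizing p q with
    | _ N ihN =>
    subst hN
    by_cases hgap : ∃ t : Fin k, q t.castSucc < p t.succ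
    · obtain ⟨t, ht⟩ := hgap
      have htt : t.castSucc < t.succ := t.castSucc_lt_succ
      have hcov : ∀ s : Fin (k + 1), s ≤ t.castSucc ∨ t.succ ≤ s := fun s => by
        simp only [Fin.le_def, Fin.val_castSucc, Fin.val_succ]; omega
      refine det_nonneg_of_merge_nonneg _
        (fun r => M (i r) (p t.succ) - M (i r) (q t.castSucc)) t ?_ ?_ ?_ ?_ ?_
      · have := ihN _ ?_ p (Function.update q t.castSucc (p t.succ)) ?_ ?_ rfl
        · convert this using 2
          ext r s
          simp only [Matrix.updateCol_apply, Matrix.of_apply, Function.update_apply, Pi.add_apply]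
          split_ifs with h
          · subst h; ring
          · rfl
        · refine Finset.sum_lt_sum (fun u _ => ?_) ⟨t, Finset.mem_univ _, ?_⟩
          · rw [Function.update_apply]
            split_ifs with h
            · rw [Fin.castSucc_inj.1 h]; omega
            · rfl
          · rw [Function.update_self]; omega
        · intro s
          rw [Function.update_apply]
          split_ifs with h
          · subst h; linarith [hpq t.castSucc]
          · exact hpq s
        · intro s s' hs
          rw [Function.update_apply]
          split_ifs with h
          · subst h
            rcases (hcov s').resolve_left hs.not_ge |>.eq_or_lt with h | h
            · rw [h]
            · exact (hpq _).le.trans (hqp _ _ h)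
          · exact hqp s s' hs
      · have := ihN _ ?_ (Function.update p t.succ (q t.castSucc)) q ?_ ?_ rfl
        · convert this using 2
          ext r s
          simp only [Matrix.updateCol_apply, Matrix.of_apply, Function.update_apply, Pi.add_apply]
          split_ifs with h
          · subst h; ring
          · rfl
        · refine Finset.sum_lt_sum (fun u _ => ?_) ⟨t, Finset.mem_univ _, ?_⟩
          · rw [Function.update_apply]
            split_ifs with h
            · rw [Fin.succ_inj.1 h]; omega
            · rfl
          · rw [Function.update_self]; omega
        · intro s
          rw [Function.update_apply]
          split_ifs with h
          · subst h; linarith [hpq t.succ]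
          · exact hpq s
        · intro s s' hs
          rw [Function.update_apply]
          split_ifs with h
          · subst h
            rcases (hcov s).resolve_right hs.not_ge |>.eq_or_lt with h | h
            · rw [h]
            · exact (hqp _ _ h).trans (hpq _).le
          · exact hqp s s' hs
      · exact fun ρ => ih _ (fun s => p (t.succ.succAbove s)) (fun s => q (t.succ.succAbove s))
          (hi.comp (Fin.strictMono_succAbove ρ)) (fun s => hpq _)
          fun s s' hs => hqp _ _ (Fin.strictMono_succAbove _ hs)
      · exact fun ρ => ih _ (fun s => p (t.castSucc.succAbove s))
          (fun s => q (t.castSucc.succAbove s))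
          (hi.comp (Fin.strictMono_succAbove ρ)) (fun s => hpq _)
          fun s s' hs => hqp _ _ (Fin.strictMono_succAbove _ hs)
      · intro ρ
        have hmono := Fin.strictMono_succAbove t.succ
        have := ih (fun s => i (ρ.succAbove s))
          (Function.update (fun s => p (t.succ.succAbove s)) t (q t.castSucc))
          (Function.update (fun s => q (t.succ.succAbove s)) t (p t.succ))
          (hi.comp (Fin.strictMono_succAbove ρ)) ?_ ?_
        · convert this using 2
          ext r s
          simp only [Matrix.updateCol_apply, Matrix.of_apply, Function.update_apply,
            Matrix.submatrix_apply]
          split_ifs <;> rfl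
        · intro s
          simp only [Function.update_apply]
          split_ifs with h
          · exact ht
          · exact hpq _
        · intro s s' hs
          simp only [Function.update_apply]
          have e := Fin.succAbove_succ_self t
          split_ifs with h h' h'
          · omega
          · subst h
            have h1 := hmono hs
            rw [e] at h1
            have h2 := ((hcov _).resolve_left h1.not_ge).lt_of_ne (Fin.succAbove_ne _ _).symm
            exact (hpq _).le.trans (hqp _ _ h2)
          · subst h'
            have h1 := hmono hs
            rw [e] at h1
            exact (hqp _ _ h1).trans (hpq _).le
          · exact hqp _ _ (hmono hs)
    · push Not at hgap
      have hadj : ∀ t : Fin k, p t.succ = q t.castSucc := fun t =>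
        le_antisymm (hgap t) (hqp _ _ t.castSucc_lt_succ)
      have := hM (k + 1) i (Fin.cons (p 0) q) hi ?_
      · refine this.trans_eq (congrArg Matrix.det (Matrix.ext fun r s => ?_))
        refine Fin.cases ?_ (fun t => ?_) s
        · simp
        · simp [hadj]
      · refine Fin.strictMono_iff_lt_succ.2 fun s => ?_
        refine Fin.cases ?_ (fun t => ?_) s
        · simpa using hpq 0
        · rw [← Fin.succ_castSucc, Fin.cons_succ, Fin.cons_succ, ← hadj]
          exact hpq _

open Filter Topology in
/-- Consecutive ratios tending to `R` force `a (n + c) / a n * R ^ c` to tend to `1`. -/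
theorem tendsto_div_mul_zpow_of_ratio (a : ℤ → ℝ) (K : ℤ) (hK : ∀ k : ℤ, K ≤ k → 0 < a k)
    (R : ℝ) (hR : 0 < R)
    (hlim : Tendsto (fun k : ℤ => a k / a (k + 1)) atTop (𝓝 R)) (c : ℤ) :
    Tendsto (fun n : ℤ => a (n + c) / a n * R ^ c) atTop (𝓝 1) := by
  have hshift (c : ℤ) : Tendsto (fun n : ℤ => a (n + c) / a (n + c + 1)) atTop (𝓝 R) :=
    hlim.comp (tendsto_atTop_add_const_right _ c tendsto_id)
  induction c using Int.induction_on with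
  | zero =>
    refine tendsto_const_nhds.congr' ?_
    filter_upwards [eventually_ge_atTop K] with n hn
    simp [(hK n hn).ne']
  | succ c ih =>
    have h := (ih.div (hshift c) hR.ne').mul_const R
    rw [one_div, inv_mul_cancel₀ hR.ne'] at h
    refine h.congr' ?_
    filter_upwards [eventually_ge_atTop K] with n hn
    have h1 := (hK n hn).ne'
    have h2 := (hK (n + c) (by omega)).ne'
    have h3 := (hK (n + c + 1) (by omega)).ne'
    simp only [Pi.div_apply]
    rw [zpow_add_one₀ hR.ne', ← add_assoc]
    field_simp
  | pred c ih =>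
    have h := (ih.mul (hshift (-c - 1))).mul_const R⁻¹
    rw [one_mul, mul_inv_cancel₀ hR.ne'] at h
    refine h.congr' ?_
    filter_upwards [eventually_ge_atTop (K + c + 1)] with n hn
    have h1 := (hK n (by omega)).ne'
    have h2 := (hK (n + (-c)) (by omega)).ne'
    rw [zpow_sub_one₀ hR.ne', show n + (-(c : ℤ) - 1) + 1 = n + (-c) by ring]
    field_simp

open Filter Topology in
/-- The weighted matrix `M i j * R ^ j` can be bordered on top by a row of ones, the limit of its
rows at `-∞`; this yields nonnegativity of its minors of adjacent column differences. -/
theorem hurwitz_det_sub_nonneg (a b : ℤ → ℝ) (hH : TotallyNonneg (hurwitz a b))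
    (K : ℤ) (hK : ∀ k : ℤ, K ≤ k → 0 < a k) (R : ℝ) (hR : 0 < R)
    (hlim : Tendsto (fun k : ℤ => a k / a (k + 1)) atTop (𝓝 R))
    (k : ℕ) (i : Fin k → ℤ) (c : Fin (k + 1) → ℤ) (hi : StrictMono i) (hc : StrictMono c) :
    0 ≤ (Matrix.of fun r s : Fin k =>
      hurwitz a b (i r) (c s.succ) * R ^ c s.succ -
        hurwitz a b (i r) (c s.castSucc) * R ^ c s.castSucc).det := by
  let W (r : ℤ) (s : ℤ) : ℝ := hurwitz a b r s * R ^ s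
  let A (v : Fin (k + 1) → ℝ) : Matrix (Fin (k + 1)) (Fin (k + 1)) ℝ :=
    Matrix.of (Fin.cons v fun r s => W (i r) (c s))
  have hones : (A 1).det = (Matrix.of fun r s : Fin k =>
      W (i r) (c s.succ) - W (i r) (c s.castSucc)).det := by
    let B : Matrix (Fin (k + 1)) (Fin (k + 1)) ℝ := Matrix.of fun r =>
      Fin.cons (A 1 r 0) fun s => A 1 r s.succ - A 1 r s.castSucc
    rw [Matrix.det_eq_of_forall_col_eq_smul_add_pred (A := A 1) (B := B) (fun _ => 1)
      (by simp [B]) (by simp [B]), Matrix.det_succ_row_zero, Fin.sum_univ_succ]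
    simp [B, A]
    rfl
  change 0 ≤ (Matrix.of fun r s : Fin k =>
      W (i r) (c s.succ) - W (i r) (c s.castSucc)).det
  rw [← hones]
  have hA : Continuous fun v => (A v).det := by
    refine Continuous.matrix_det (continuous_matrix fun r s => ?_)
    refine Fin.cases ?_ (fun r => ?_) r
    · simpa [A] using continuous_apply s
    · simpa [A] using continuous_const
  have hrow : Tendsto (fun n : ℤ => fun s => a (n + c s) / a n * R ^ c s) atTop
      (𝓝 (1 : Fin (k + 1) → ℝ)) :=
    tendsto_pi_nhds.2 fun s => tendsto_div_mul_zpow_of_ratio a K hK R hR hlim (c s)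
  refine ge_of_tendsto ((hA.tendsto _).comp hrow) ?_
  have hbd : ∃ L : ℤ, ∀ r, L ≤ i r := by
    obtain ⟨L, hL⟩ := (Set.finite_range i).bddBelow
    exact ⟨L, fun r => hL ⟨r, rfl⟩⟩
  obtain ⟨L, hL⟩ := hbd
  filter_upwards [eventually_ge_atTop K, eventually_ge_atTop (|L| + 1)] with n hnK hnL
  have hmono : StrictMono (Fin.cons (-2 * n) i : Fin (k + 1) → ℤ) := by
    refine Fin.strictMono_cons.2 ⟨fun r => ?_, hi⟩
    have := hL r
    have := neg_abs_le L
    have := abs_nonneg L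
    omega
  have hmin := hH (k + 1) (Fin.cons (-2 * n) i) c hmono hc
  have han := hK n hnK
  let w : Fin (k + 1) → ℝ := Fin.cons (a n)⁻¹ 1
  have hw : ∀ r, 0 ≤ w r := Fin.cases (by simp [w, han.le]) (by simp [w])
  have heq : A (fun s => a (n + c s) / a n * R ^ c s) = Matrix.of fun r s => w r *
      (Matrix.of fun r s => R ^ c s * (Matrix.of fun r s =>
        hurwitz a b ((Fin.cons (-2 * n) i : Fin (k + 1) → ℤ) r) (c s)) r s) r s := by
    ext r s
    refine Fin.cases ?_ (fun r => ?_) r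
    · have h2 : (2 : ℤ) ∣ -2 * n := ⟨-n, by ring⟩
      have h3 : -2 * n / 2 = -n := by omega
      simp only [A, w, Matrix.of_apply, Fin.cons_zero, hurwitz, h2, if_true, h3]
      rw [sub_neg_eq_add, add_comm (c s) n]
      ring
    · simp [A, w, W, mul_comm]
  simp only [Function.comp_apply]
  rw [heq, Matrix.det_mul_column, Matrix.det_mul_row]
  exact mul_nonneg (Finset.prod_nonneg fun r _ => hw r)
    (mul_nonneg (Finset.prod_nonneg fun s _ => (zpow_pos hR _).le) hmin)

theorem stmt9 (a b : ℤ → ℝ) (ha : ∃ n, a n ≠ 0) (hb : ∃ n, b n ≠ 0)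
    (hH : TotallyNonneg (hurwitz a b))
    (K : ℤ) (hK : ∀ k : ℤ, K ≤ k → 0 < a k)
    (R : ℝ) (hR : 0 < R)
    (hlim : Filter.Tendsto (fun k : ℤ => a k / a (k + 1)) Filter.atTop (nhds R)) :
    TotallyNonneg (hurwitz (fun k => a k - a (k - 1) / R) (fun k => b k - b (k - 1) / R)) := by
  intro k i j hi hj
  have hdiff := det_interval_sub_nonneg (fun r s => hurwitz a b r s * R ^ s)
    (hurwitz_det_sub_nonneg a b hH K hK R hR hlim) k i (fun s => j s - 1) j hi
    (fun s => sub_one_lt _) (fun s s' hs => Int.le_sub_one_of_lt (hj hs))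
  have hentry : ∀ r s : ℤ,
      hurwitz (fun k => a k - a (k - 1) / R) (fun k => b k - b (k - 1) / R) r s =
        (R ^ s)⁻¹ * (hurwitz a b r s * R ^ s - hurwitz a b r (s - 1) * R ^ (s - 1)) := by
    intro r s
    have hs := (zpow_pos hR s).ne'
    rw [zpow_sub_one₀ hR.ne']
    simp only [hurwitz]
    split_ifs
    · rw [sub_right_comm s 1]
      field_simp
    · rw [sub_right_comm s 1]
      field_simp
  simp only [hentry]
  have hscale := Matrix.det_mul_row (fun s => (R ^ j s)⁻¹) (Matrix.of fun r s =>
    hurwitz a b (i r) (j s) * R ^ j s - hurwitz a b (i r) (j s - 1) * R ^ (j s - 1))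
  simp only [Matrix.of_apply] at hscale
  rw [hscale]
  exact mul_nonneg (Finset.prod_nonneg fun s _ => (inv_pos.2 (zpow_pos hR _)).le) hdiff
end

section
/- Let C > 0 and let α⁺, β⁺, α⁻, β⁻ : ℕ → ℝ (indexed by ν = 1, 2, …) be positive sequences satisfying the interlacing chain 0 < ⋯ < 1/α⁻_2 < 1/β⁻_1 < 1/α⁻_1 < β⁺_1 < α⁺_1 < β⁺_2 < α⁺_2 < ⋯ and the summability condition Σ_ν (1/α⁺_ν + 1/β⁺_ν + 1/α⁻_ν + 1/β⁻_ν) < ∞. Then for every z ∈ ℂ ∖ (−∞,0] all four infinite products below converge, and the function F(z) = C · ∏_{ν≥1} (1 + z/β⁺_ν)/(1 + z/α⁺_ν) · ∏_{ν≥1} (1 + z⁻¹/β⁻_ν)/(1 + z⁻¹/α⁻_ν) is an S-function: it is holomorphic on ℂ ∖ (−∞,0], satisfies Im z · Im F(z) ≥ 0 there, and F(x) ≥ 0 for every real x > 0. -/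
open Complex

/-- The slit plane `ℂ ∖ (−∞, 0]`. -/
def SDom : Set ℂ := {z : ℂ | ¬ (z.im = 0 ∧ z.re ≤ 0)}

/-- `F` is an `𝒮`-function: holomorphic on `ℂ ∖ (−∞,0]`, with
`Im z · Im F(z) ≥ 0` there, and `F(x) ≥ 0` (real) for real `x > 0`. -/
def IsSFun (F : ℂ → ℂ) : Prop :=
  DifferentiableOn ℂ F SDom ∧
  (∀ z ∈ SDom, 0 ≤ z.im * (F z).im) ∧
  (∀ x : ℝ, 0 < x → (F (x : ℂ)).im = 0 ∧ 0 ≤ (F (x : ℂ)).re)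

open Filter in
/-- The canonical product with negative zeros at `-a ν` is entire. -/
lemma differentiable_tprod_one_add_div {a : ℕ → ℝ} (ha : Summable fun ν => (a ν)⁻¹)
    (hpos : ∀ ν, 0 < a ν) :
    Differentiable ℂ fun z : ℂ => ∏' ν, (1 + z / (a ν : ℂ)) := by
  intro z
  set R : ℝ := ‖z‖ + 1
  have h := Summable.hasProdLocallyUniformlyOn_nat_one_add (f := fun (ν : ℕ) (w : ℂ) => w / (a ν : ℂ))
    (Metric.isOpen_ball (x := (0 : ℂ)) (ε := R)) (ha.mul_left R)
    (Eventually.of_forall fun ν w hw => by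
      rw [norm_div, norm_real, Real.norm_of_nonneg (hpos ν).le, div_eq_mul_inv]
      have := (hpos ν).le
      gcongr
      exact (mem_ball_zero_iff.mp hw).le)
    (fun ν => by fun_prop)
  have hd := h.differentiableOn
    (Eventually.of_forall fun s => by fun_prop) Metric.isOpen_ball
  exact hd.differentiableAt (Metric.isOpen_ball.mem_nhds (by simp [R]))

lemma one_add_div_ne_zero {z : ℂ} (hz : z ∈ SDom) {a : ℝ} (ha : 0 < a) :
    1 + z / (a : ℂ) ≠ 0 := by
  intro h
  have ha' : (a : ℂ) ≠ 0 := ofReal_ne_zero.mpr ha.ne'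
  have hza : z = ((-a : ℝ) : ℂ) := by
    field_simp at h
    push_cast
    linear_combination h
  exact hz (by simp [hza, ha.le])

lemma summable_norm_div {a : ℕ → ℝ} (ha : Summable fun ν => (a ν)⁻¹) (z : ℂ) :
    Summable fun ν => ‖z / (a ν : ℂ)‖ := by
  simpa [div_eq_mul_inv] using ha.abs.mul_left ‖z‖

lemma tprod_one_add_div_ne_zero {a : ℕ → ℝ} (ha : Summable fun ν => (a ν)⁻¹)
    (hpos : ∀ ν, 0 < a ν) {z : ℂ} (hz : z ∈ SDom) :
    ∏' ν, (1 + z / (a ν : ℂ)) ≠ 0 :=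
  tprod_one_add_ne_zero_of_summable (fun ν => one_add_div_ne_zero hz (hpos ν))
    (summable_norm_div ha z)

lemma hasProd_one_add_div_div {a b : ℕ → ℝ} (ha : Summable fun ν => (a ν)⁻¹)
    (hb : Summable fun ν => (b ν)⁻¹) (hpos : ∀ ν, 0 < a ν) {z : ℂ} (hz : z ∈ SDom) :
    HasProd (fun ν : ℕ => (1 + z / (b ν : ℂ)) / (1 + z / (a ν : ℂ)))
      ((∏' ν, (1 + z / (b ν : ℂ))) / ∏' ν, (1 + z / (a ν : ℂ))) :=
  (multipliable_one_add_of_summable (summable_norm_div hb z)).hasProd.div₀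
    (multipliable_one_add_of_summable (summable_norm_div ha z)).hasProd
    (tprod_one_add_div_ne_zero ha hpos hz)

lemma differentiableOn_tprod_one_add_div_div {a b : ℕ → ℝ} (ha : Summable fun ν => (a ν)⁻¹)
    (hb : Summable fun ν => (b ν)⁻¹) (hapos : ∀ ν, 0 < a ν) (hbpos : ∀ ν, 0 < b ν) :
    DifferentiableOn ℂ (fun z => ∏' ν : ℕ, (1 + z / (b ν : ℂ)) / (1 + z / (a ν : ℂ))) SDom :=
  ((differentiable_tprod_one_add_div hb hbpos).differentiableOn.fun_div
    (differentiable_tprod_one_add_div ha hapos).differentiableOn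
    fun _ hz => tprod_one_add_div_ne_zero ha hapos hz).congr
    fun _ hz => (hasProd_one_add_div_div ha hb hapos hz).tprod_eq

lemma ne_zero_of_mem_SDom {z : ℂ} (hz : z ∈ SDom) : z ≠ 0 := by
  rintro rfl
  exact hz (by simp)

lemma inv_mem_SDom {z : ℂ} (hz : z ∈ SDom) : z⁻¹ ∈ SDom := by
  rintro ⟨h1, h2⟩
  have hn : 0 < normSq z := normSq_pos.mpr (ne_zero_of_mem_SDom hz)
  rw [inv_im, div_eq_zero_iff, or_iff_left hn.ne'] at h1
  rw [inv_re, div_nonpos_iff] at h2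
  exact hz ⟨by linarith, by rcases h2 with h | h <;> linarith [h.1, h.2]⟩

/-- For `z` in the upper half-plane, `π / 2 - coarg z t` is the argument of `z + t`. -/
noncomputable def coarg (z : ℂ) (t : ℝ) : ℝ := Real.arctan ((z.re + t) / z.im)

lemma coarg_mono {z : ℂ} (hz : 0 < z.im) : Monotone (coarg z) := fun s t h => by
  refine Real.arctan_mono ?_
  gcongr

lemma exists_add_ofReal_eq_coarg {z : ℂ} (hz : 0 < z.im) (t : ℝ) :
    ∃ r : ℝ, 0 < r ∧ z + t = r * (I * exp (-(coarg z t * I))) := by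
  have hc : 0 < Real.cos (coarg z t) := Real.cos_arctan_pos _
  have ht : Real.tan (coarg z t) = (z.re + t) / z.im := Real.tan_arctan _
  rw [Real.tan_eq_sin_div_cos, div_eq_div_iff hc.ne' hz.ne'] at ht
  refine ⟨z.im / Real.cos (coarg z t), by positivity, ?_⟩
  rw [← neg_mul, ← ofReal_neg, exp_mul_I, ← ofReal_cos, ← ofReal_sin, Real.cos_neg, Real.sin_neg]
  generalize Real.cos (coarg z t) = c at hc ht ⊢
  generalize Real.sin (coarg z t) = s at ht ⊢
  apply Complex.ext
  · rw [re_ofReal_mul]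
    simp
    field_simp
    linarith
  · rw [im_ofReal_mul]
    simp
    field_simp

lemma exists_add_div_add_eq_coarg {z : ℂ} (hz : 0 < z.im) (s t : ℝ) :
    ∃ r : ℝ, 0 < r ∧ (z + s) / (z + t) = r * exp ((coarg z t - coarg z s : ℝ) * I) := by
  obtain ⟨r, hr, h⟩ := exists_add_ofReal_eq_coarg hz s
  obtain ⟨q, hq, h'⟩ := exists_add_ofReal_eq_coarg hz t
  refine ⟨r / q, by positivity, ?_⟩
  have hq' : (q : ℂ) ≠ 0 := ofReal_ne_zero.mpr hq.ne'
  have e : exp ((coarg z t - coarg z s : ℝ) * I) * exp (-(coarg z t * I))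
      = exp (-(coarg z s * I)) := by
    rw [← exp_add]
    congr 1
    push_cast
    ring
  rw [h, h', ← e]
  have := exp_ne_zero (-(coarg z t * I))
  push_cast
  field_simp

lemma exists_prod_eq_mul_exp_sum {ι : Type*} (s : Finset ι) {f : ι → ℂ} {θ : ι → ℝ}
    (h : ∀ i, ∃ r : ℝ, 0 < r ∧ f i = r * exp (θ i * I)) :
    ∃ r : ℝ, 0 < r ∧ ∏ i ∈ s, f i = r * exp ((∑ i ∈ s, θ i : ℝ) * I) := by
  choose r hr hf using h
  refine ⟨∏ i ∈ s, r i, Finset.prod_pos fun i _ => hr i, ?_⟩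
  simp_rw [hf, Finset.prod_mul_distrib, ← exp_sum, ← Finset.sum_mul]
  push_cast
  rfl

lemma sum_sub_le_of_interlacing {φ : ℝ → ℝ} (hφ : Monotone φ) {a b : ℕ → ℝ}
    (h : ∀ ν, a ν ≤ b (ν + 1)) (N : ℕ) :
    ∑ ν ∈ Finset.range N, (φ (a ν) - φ (b ν)) ≤ φ (b N) - φ (b 0) := by
  rw [← Finset.sum_range_sub (fun ν => φ (b ν))]
  exact Finset.sum_le_sum fun ν _ => sub_le_sub_right (hφ (h ν)) _

/-- The finite products of an interlacing chain map the upper half-plane to its closure. -/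
lemma im_prod_nonneg {z : ℂ} (hz : 0 < z.im) {αp βp a b : ℕ → ℝ}
    (hp : ∀ ν, 0 < αp ν ∧ 0 < βp ν)
    (hc1 : ∀ ν, b ν ≤ a ν) (hc2 : ∀ ν, a (ν + 1) ≤ b ν) (hc3 : a 0 ≤ βp 0)
    (hc4 : ∀ ν, βp ν ≤ αp ν) (hc5 : ∀ ν, αp ν ≤ βp (ν + 1)) (N : ℕ) :
    0 ≤ ((∏ ν ∈ Finset.range N, (1 + z / (βp ν : ℂ)) / (1 + z / (αp ν : ℂ))) *
      ∏ ν ∈ Finset.range N, (z + b ν) / (z + a ν)).im := by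
  have hmono := coarg_mono hz
  have hP (ν : ℕ) : ∃ r : ℝ, 0 < r ∧ (1 + z / (βp ν : ℂ)) / (1 + z / (αp ν : ℂ)) =
      r * exp ((coarg z (αp ν) - coarg z (βp ν) : ℝ) * I) := by
    obtain ⟨hα, hβ⟩ := hp ν
    obtain ⟨r, hr, h⟩ := exists_add_div_add_eq_coarg hz (βp ν) (αp ν)
    refine ⟨αp ν / βp ν * r, by positivity, ?_⟩
    rw [ofReal_mul, mul_assoc, ← h]
    have hα' : (αp ν : ℂ) ≠ 0 := ofReal_ne_zero.mpr hα.ne'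
    have hβ' : (βp ν : ℂ) ≠ 0 := ofReal_ne_zero.mpr hβ.ne'
    push_cast
    rw [one_add_div hα', one_add_div hβ', div_div_div_eq, div_mul_div_comm]
    ring
  obtain ⟨r, hr, h⟩ := exists_prod_eq_mul_exp_sum (Finset.range N) hP
  obtain ⟨q, hq, h'⟩ := exists_prod_eq_mul_exp_sum (Finset.range N)
    fun ν => exists_add_div_add_eq_coarg hz (b ν) (a ν)
  set S := ∑ ν ∈ Finset.range N, (coarg z (αp ν) - coarg z (βp ν))
  set T := ∑ ν ∈ Finset.range N, (coarg z (a ν) - coarg z (b ν))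
  have hS : S ≤ coarg z (βp N) - coarg z (βp 0) := sum_sub_le_of_interlacing hmono hc5 N
  have hT : T ≤ coarg z (a 0) - coarg z (a N) := by
    rw [← Finset.sum_range_sub' (fun ν => coarg z (a ν))]
    exact Finset.sum_le_sum fun ν _ => sub_le_sub_left (hmono (hc2 ν)) _
  have hS0 : 0 ≤ S := Finset.sum_nonneg fun ν _ => sub_nonneg.mpr (hmono (hc4 ν))
  have hT0 : 0 ≤ T := Finset.sum_nonneg fun ν _ => sub_nonneg.mpr (hmono (hc1 ν))
  have h1 : coarg z (βp N) < Real.pi / 2 := Real.arctan_lt_pi_div_two _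
  have h2 : -(Real.pi / 2) < coarg z (a N) := Real.neg_pi_div_two_lt_arctan _
  have h3 := hmono hc3
  have e : (r : ℂ) * exp (S * I) * (q * exp (T * I)) = (r * q : ℝ) * exp ((S + T : ℝ) * I) := by
    push_cast
    rw [add_mul, exp_add]
    ring
  rw [h, h', e, im_ofReal_mul, exp_ofReal_mul_I_im]
  exact mul_nonneg (by positivity)
    (Real.sin_nonneg_of_nonneg_of_le_pi (by linarith) (by linarith))

theorem stmt11 (C : ℝ) (αp βp αm βm : ℕ → ℝ) (hC : 0 < C)
    (hpos : ∀ ν, 0 < αp ν ∧ 0 < βp ν ∧ 0 < αm ν ∧ 0 < βm ν)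
    -- the interlacing chain 0 < ⋯ < 1/α⁻₂ < 1/β⁻₁ < 1/α⁻₁ < β⁺₁ < α⁺₁ < β⁺₂ < α⁺₂ < ⋯ :
    (hc1 : ∀ ν, (βm ν)⁻¹ < (αm ν)⁻¹)
    (hc2 : ∀ ν, (αm (ν + 1))⁻¹ < (βm ν)⁻¹)
    (hc3 : (αm 0)⁻¹ < βp 0)
    (hc4 : ∀ ν, βp ν < αp ν)
    (hc5 : ∀ ν, αp ν < βp (ν + 1))
    (hsum : Summable fun ν => (αp ν)⁻¹ + (βp ν)⁻¹ + (αm ν)⁻¹ + (βm ν)⁻¹) :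
    (∀ z ∈ SDom,
      Multipliable (fun ν : ℕ => (1 + z / (βp ν : ℂ)) / (1 + z / (αp ν : ℂ))) ∧
      Multipliable (fun ν : ℕ => (1 + z⁻¹ / (βm ν : ℂ)) / (1 + z⁻¹ / (αm ν : ℂ)))) ∧
    IsSFun (fun z =>
      (C : ℂ) * (∏' ν : ℕ, (1 + z / (βp ν : ℂ)) / (1 + z / (αp ν : ℂ))) *
        (∏' ν : ℕ, (1 + z⁻¹ / (βm ν : ℂ)) / (1 + z⁻¹ / (αm ν : ℂ)))) := by
  have hαp : Summable fun ν => (αp ν)⁻¹ := hsum.of_nonneg_of_le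
    (fun ν => (inv_pos.mpr (hpos ν).1).le) fun ν => by
      obtain ⟨h1, h2, h3, h4⟩ := hpos ν
      linarith [inv_pos.mpr h1, inv_pos.mpr h2, inv_pos.mpr h3, inv_pos.mpr h4]
  have hβp : Summable fun ν => (βp ν)⁻¹ := hsum.of_nonneg_of_le
    (fun ν => (inv_pos.mpr (hpos ν).2.1).le) fun ν => by
      obtain ⟨h1, h2, h3, h4⟩ := hpos ν
      linarith [inv_pos.mpr h1, inv_pos.mpr h2, inv_pos.mpr h3, inv_pos.mpr h4]
  have hαm : Summable fun ν => (αm ν)⁻¹ := hsum.of_nonneg_of_le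
    (fun ν => (inv_pos.mpr (hpos ν).2.2.1).le) fun ν => by
      obtain ⟨h1, h2, h3, h4⟩ := hpos ν
      linarith [inv_pos.mpr h1, inv_pos.mpr h2, inv_pos.mpr h3, inv_pos.mpr h4]
  have hβm : Summable fun ν => (βm ν)⁻¹ := hsum.of_nonneg_of_le
    (fun ν => (inv_pos.mpr (hpos ν).2.2.2).le) fun ν => by
      obtain ⟨h1, h2, h3, h4⟩ := hpos ν
      linarith [inv_pos.mpr h1, inv_pos.mpr h2, inv_pos.mpr h3, inv_pos.mpr h4]
  have hmul : ∀ z ∈ SDom,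
      Multipliable (fun ν : ℕ => (1 + z / (βp ν : ℂ)) / (1 + z / (αp ν : ℂ))) ∧
      Multipliable (fun ν : ℕ => (1 + z⁻¹ / (βm ν : ℂ)) / (1 + z⁻¹ / (αm ν : ℂ))) :=
    fun z hz => ⟨(hasProd_one_add_div_div hαp hβp (fun ν => (hpos ν).1) hz).multipliable,
      (hasProd_one_add_div_div hαm hβm (fun ν => (hpos ν).2.2.1) (inv_mem_SDom hz)).multipliable⟩
  set F : ℂ → ℂ := fun z =>
      (C : ℂ) * (∏' ν : ℕ, (1 + z / (βp ν : ℂ)) / (1 + z / (αp ν : ℂ))) *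
        (∏' ν : ℕ, (1 + z⁻¹ / (βm ν : ℂ)) / (1 + z⁻¹ / (αm ν : ℂ))) with hF
  set P : ℕ → ℂ → ℂ := fun N z => (C : ℂ) *
      (∏ ν ∈ Finset.range N, (1 + z / (βp ν : ℂ)) / (1 + z / (αp ν : ℂ))) *
      ∏ ν ∈ Finset.range N, (1 + z⁻¹ / (βm ν : ℂ)) / (1 + z⁻¹ / (αm ν : ℂ)) with hP
  have hlim : ∀ z ∈ SDom, Filter.Tendsto (fun N => P N z) Filter.atTop (nhds (F z)) :=
    fun z hz => ((hmul z hz).1.hasProd.tendsto_prod_nat.const_mul _).mul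
      (hmul z hz).2.hasProd.tendsto_prod_nat
  have hupper (N : ℕ) (z : ℂ) (hz : 0 < z.im) : 0 ≤ (P N z).im := by
    have hz0 : z ≠ 0 := by
      rintro rfl
      simp at hz
    have hfac (ν : ℕ) : (1 + z⁻¹ / (βm ν : ℂ)) / (1 + z⁻¹ / (αm ν : ℂ)) =
        (z + ((βm ν)⁻¹ : ℝ)) / (z + ((αm ν)⁻¹ : ℝ)) := by
      have key (a : ℝ) : 1 + z⁻¹ / (a : ℂ) = (z + (a⁻¹ : ℝ)) / z := by
        push_cast
        field_simp
      rw [key, key, div_div_div_cancel_right₀ hz0]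
    simp only [hP, hfac, mul_assoc, im_ofReal_mul]
    exact mul_nonneg hC.le <| im_prod_nonneg hz (fun ν => ⟨(hpos ν).1, (hpos ν).2.1⟩)
      (fun ν => (hc1 ν).le) (fun ν => (hc2 ν).le) hc3.le (fun ν => (hc4 ν).le)
      (fun ν => (hc5 ν).le) N
  have hconj (N : ℕ) (z : ℂ) : P N (starRingEnd ℂ z) = starRingEnd ℂ (P N z) := by
    simp [hP, map_prod]
  refine ⟨hmul, ?_, fun z hz => ?_, fun x hx => ?_⟩
  · exact ((differentiableOn_tprod_one_add_div_div hαp hβp (fun ν => (hpos ν).1)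
      fun ν => (hpos ν).2.1).const_mul _).mul
      ((differentiableOn_tprod_one_add_div_div hαm hβm (fun ν => (hpos ν).2.2.1)
        fun ν => (hpos ν).2.2.2).comp
        (fun z hz => (differentiableAt_inv (ne_zero_of_mem_SDom hz)).differentiableWithinAt)
        fun z hz => inv_mem_SDom hz)
  · refine ge_of_tendsto' (((continuous_im.tendsto _).comp (hlim z hz)).const_mul z.im)
      fun N => ?_
    rcases lt_trichotomy z.im 0 with h | h | h
    · have := hupper N (starRingEnd ℂ z) (by simpa using h)
      rw [hconj, conj_im] at this
      exact mul_nonneg_of_nonpos_of_nonpos h.le (by simpa using this)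
    · simp [h]
    · exact mul_nonneg h.le (hupper N z h)
  · have hx' : (x : ℂ) ∈ SDom := fun h => by
      simp at h
      linarith
    have hreal (N : ℕ) : ∃ r : ℝ, 0 ≤ r ∧ P N x = r := by
      refine ⟨C * (∏ ν ∈ Finset.range N, (1 + x / βp ν) / (1 + x / αp ν)) *
        ∏ ν ∈ Finset.range N, (1 + x⁻¹ / βm ν) / (1 + x⁻¹ / αm ν), ?_, by simp [hP]⟩
      refine mul_nonneg (mul_nonneg hC.le (Finset.prod_nonneg fun ν _ => ?_))
        (Finset.prod_nonneg fun ν _ => ?_) <;>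
      · obtain ⟨h1, h2, h3, h4⟩ := hpos ν
        positivity
    choose r hr hPr using hreal
    have him := (continuous_im.tendsto _).comp (hlim x hx')
    have hre := (continuous_re.tendsto _).comp (hlim x hx')
    refine ⟨tendsto_nhds_unique him ?_, ge_of_tendsto' hre fun N => ?_⟩
    · simp [Function.comp_def, hPr]
    · simpa [hPr] using hr N
end

section
/- Let C ≥ 0 and let β, α : ℕ → ℝ (with β₀, α₀ the zeroth entries) satisfy 0 ≤ β₀ < α₀ < β₁ < α₁ < β₂ < α₂ < ⋯ together with the summability condition Σ_{ν≥1} (1/α_ν + 1/β_ν) < ∞. Then for every z ∈ ℂ ∖ (−∞,0] the infinite product below converges, and the function F(z) = C · (z + β₀)/(z + α₀) · ∏_{ν≥1} (1 + z/β_ν)/(1 + z/α_ν) is an S-function: it is holomorphic on ℂ ∖ (−∞,0], satisfies Im z · Im F(z) ≥ 0 there, and F(x) ≥ 0 for every real x > 0. -/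
open Complex

open Filter Topology

lemma SDom_eq_slitPlane : SDom = slitPlane := by
  ext z
  simp only [SDom, Set.mem_ofPred_eq, mem_slitPlane_iff]
  grind

lemma add_ofReal_ne_zero_of_mem_slitPlane {z : ℂ} (hz : z ∈ slitPlane) {a : ℝ} (ha : 0 ≤ a) :
    z + a ≠ 0 := by
  intro h
  have h1 := congrArg re h
  have h2 := congrArg im h
  simp only [add_re, ofReal_re, zero_re, add_im, ofReal_im, add_zero, zero_im] at h1 h2
  rcases mem_slitPlane_iff.mp hz with h3 | h3
  · linarith
  · exact h3 h2

lemma one_add_div_ofReal_ne_zero {z : ℂ} (hz : z ∈ slitPlane) {a : ℝ} (ha : 0 < a) :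
    1 + z / a ≠ 0 := by
  have ha' : (a : ℂ) ≠ 0 := ofReal_ne_zero.mpr ha.ne'
  have h := add_ofReal_ne_zero_of_mem_slitPlane hz ha.le
  rw [one_add_div ha', add_comm]
  exact div_ne_zero h ha'

lemma norm_one_add_div_div_one_add_div_sub_one_le {z : ℂ} {a b R : ℝ} (ha : 0 < a) (hb : 0 < b)
    (hz : ‖z‖ ≤ R) (hR : R * a⁻¹ ≤ 1 / 2) :
    ‖(1 + z / b) / (1 + z / a) - 1‖ ≤ 2 * R * (a⁻¹ + b⁻¹) := by
  have hza : ‖z / (a : ℂ)‖ ≤ R * a⁻¹ := by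
    rw [norm_div, norm_real, Real.norm_of_nonneg ha.le, div_eq_mul_inv]
    gcongr
  have hzb : ‖z / (b : ℂ)‖ ≤ R * b⁻¹ := by
    rw [norm_div, norm_real, Real.norm_of_nonneg hb.le, div_eq_mul_inv]
    gcongr
  have hden : 1 / 2 ≤ ‖1 + z / (a : ℂ)‖ := by
    have h := norm_sub_norm_le (1 : ℂ) (-(z / (a : ℂ)))
    rw [norm_neg, norm_one, sub_neg_eq_add] at h
    linarith
  have hne : 1 + z / (a : ℂ) ≠ 0 := norm_pos_iff.mp (by linarith)
  rw [div_sub_one hne, norm_div, div_le_iff₀ (by linarith),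
    show 1 + z / (b : ℂ) - (1 + z / a) = z / b - z / a by ring]
  have hnn : 0 ≤ 2 * R * (a⁻¹ + b⁻¹) := by
    have := (norm_nonneg z).trans hz
    positivity
  calc ‖z / (b : ℂ) - z / a‖ ≤ ‖z / (b : ℂ)‖ + ‖z / (a : ℂ)‖ := norm_sub_le _ _
    _ ≤ 2 * R * (a⁻¹ + b⁻¹) * (1 / 2) := by linarith
    _ ≤ _ := by gcongr

lemma hasProdLocallyUniformlyOn_slitPlane {a b : ℕ → ℝ} (ha : ∀ n, 0 < a n) (hb : ∀ n, 0 < b n)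
    (hsum : Summable fun n => (a n)⁻¹ + (b n)⁻¹) :
    HasProdLocallyUniformlyOn (fun n (z : ℂ) => (1 + z / b n) / (1 + z / a n))
      (fun z => ∏' n, (1 + z / b n) / (1 + z / a n)) slitPlane := by
  refine hasProdLocallyUniformlyOn_of_forall_compact isOpen_slitPlane fun K hK hKc => ?_
  obtain ⟨R, hR⟩ := hKc.isBounded.exists_norm_le
  have hsa : Summable fun n => (a n)⁻¹ :=
    hsum.of_nonneg_of_le (fun n => (inv_pos.mpr (ha n)).le)
      fun n => le_add_of_nonneg_right (inv_pos.mpr (hb n)).le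
  have hlim : Tendsto (fun n => R * (a n)⁻¹) atTop (𝓝 0) := by
    simpa using hsa.tendsto_atTop_zero.const_mul R
  have h := Summable.hasProdUniformlyOn_nat_one_add
    (f := fun n (z : ℂ) => (1 + z / b n) / (1 + z / a n) - 1) hKc (hsum.mul_left (2 * R))
    (by
      filter_upwards [hlim.eventually_le_const (show (0 : ℝ) < 1 / 2 by norm_num)] with n hn z hz
      exact norm_one_add_div_div_one_add_div_sub_one_le (ha n) (hb n) (hR z hz) hn)
    (fun n => ContinuousOn.sub (ContinuousOn.div (by fun_prop) (by fun_prop)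
      fun z hz => one_add_div_ofReal_ne_zero (hK hz) (ha n)) continuousOn_const)
  simpa only [add_sub_cancel] using h

lemma arg_add_ofReal_le_arg_add_ofReal {z : ℂ} (hz : 0 < z.im) {a b : ℝ} (hab : a ≤ b) :
    arg (z + b) ≤ arg (z + a) := by
  have him (t : ℝ) : (z + t).im = z.im := by simp
  have hre (t : ℝ) : (z + t).re = z.re + t := by simp
  have hne (t : ℝ) : z + t ≠ 0 := fun h => by
    have := him t
    rw [h, zero_im] at this
    exact hz.ne this
  by_contra! h
  have h1 : 0 ≤ arg (z + a) := arg_nonneg_iff.mpr (him a ▸ hz.le)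
  have h2 : arg (z + b) < Real.pi :=
    lt_of_le_of_ne (arg_le_pi _) fun h => hz.ne' (him b ▸ (arg_eq_pi_iff.mp h).2)
  have h3 := Real.sin_pos_of_pos_of_lt_pi (x := arg (z + b) - arg (z + a)) (by linarith)
    (by linarith)
  rw [Real.sin_sub, sin_arg, sin_arg, cos_arg (hne a), cos_arg (hne b), him, him, hre, hre,
    div_mul_div_comm, div_mul_div_comm, mul_comm ‖z + (b : ℂ)‖, ← sub_div] at h3
  have hp := (div_pos_iff_of_pos_right
    (mul_pos (norm_pos_iff.mpr (hne a)) (norm_pos_iff.mpr (hne b)))).mp h3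
  nlinarith

lemma exists_add_div_add_eq_mul_exp (z : ℂ) (a b : ℝ) :
    ∃ r : ℝ, 0 ≤ r ∧ (z + b) / (z + a) = r * exp (((arg (z + b) - arg (z + a) : ℝ) : ℂ) * I) := by
  refine ⟨‖z + b‖ / ‖z + a‖, by positivity, ?_⟩
  conv_lhs => rw [← norm_mul_exp_arg_mul_I (z + b), ← norm_mul_exp_arg_mul_I (z + a)]
  push_cast
  rw [sub_mul, exp_sub, div_mul_div_comm]

lemma exists_prod_eq_mul_exp {β α : ℕ → ℝ} (hpos : ∀ n, 0 < α n)
    (hc1 : ∀ n, β n < α n) (hc2 : ∀ n, α n < β (n + 1)) {z : ℂ} (hz : 0 < z.im) (n : ℕ) :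
    ∃ r θ : ℝ, 0 ≤ r ∧ 0 ≤ θ ∧ θ ≤ arg (z + β 0) - arg (z + α n) ∧
      (z + β 0) / (z + α 0) * ∏ k ∈ Finset.range n, (1 + z / β (k + 1)) / (1 + z / α (k + 1)) =
        r * exp (θ * I) := by
  induction n with
  | zero =>
    obtain ⟨r, hr, h⟩ := exists_add_div_add_eq_mul_exp z (α 0) (β 0)
    exact ⟨r, _, hr, sub_nonneg.mpr (arg_add_ofReal_le_arg_add_ofReal hz (hc1 0).le), le_rfl,
      by simpa using h⟩
  | succ n ih =>
    obtain ⟨r, θ, hr, hθ, hθ', h⟩ := ih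
    obtain ⟨s, hs, h'⟩ := exists_add_div_add_eq_mul_exp z (α (n + 1)) (β (n + 1))
    have hα := hpos (n + 1)
    have hβ : 0 < β (n + 1) := (hpos n).trans (hc2 n)
    have h1 := arg_add_ofReal_le_arg_add_ofReal hz (hc1 (n + 1)).le
    have h2 := arg_add_ofReal_le_arg_add_ofReal hz (hc2 n).le
    refine ⟨r * (α (n + 1) / β (n + 1) * s), θ + (arg (z + β (n + 1)) - arg (z + α (n + 1))),
      by positivity, by linarith, by linarith, ?_⟩
    have hα' : (α (n + 1) : ℂ) ≠ 0 := ofReal_ne_zero.mpr hα.ne'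
    have hβ' : (β (n + 1) : ℂ) ≠ 0 := ofReal_ne_zero.mpr hβ.ne'
    have hfac : (1 + z / β (n + 1)) / (1 + z / α (n + 1)) =
        (α (n + 1) / β (n + 1) : ℂ) * ((z + β (n + 1)) / (z + α (n + 1))) := by
      rw [one_add_div hα', one_add_div hβ', div_div_div_eq, div_mul_div_comm]
      ring
    rw [Finset.prod_range_succ, ← mul_assoc, h, hfac, h', ofReal_add, add_mul, exp_add]
    push_cast
    ring

lemma im_prod_nonneg_s12 {β α : ℕ → ℝ} (hpos : ∀ n, 0 < α n)
    (hc1 : ∀ n, β n < α n) (hc2 : ∀ n, α n < β (n + 1)) {z : ℂ} (hz : 0 < z.im) (n : ℕ) :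
    0 ≤ ((z + β 0) / (z + α 0) *
      ∏ k ∈ Finset.range n, (1 + z / β (k + 1)) / (1 + z / α (k + 1))).im := by
  obtain ⟨r, θ, hr, hθ, hθ', h⟩ := exists_prod_eq_mul_exp hpos hc1 hc2 hz n
  have h1 : 0 ≤ arg (z + α n) := arg_nonneg_iff.mpr (by simpa using hz.le)
  have h2 := arg_le_pi (z + β 0)
  rw [h, im_ofReal_mul, exp_ofReal_mul_I_im]
  exact mul_nonneg hr (Real.sin_nonneg_of_nonneg_of_le_pi hθ (by linarith))

lemma im_mul_im_prod_nonneg {β α : ℕ → ℝ} (hpos : ∀ n, 0 < α n)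
    (hc1 : ∀ n, β n < α n) (hc2 : ∀ n, α n < β (n + 1)) (z : ℂ) (n : ℕ) :
    0 ≤ z.im * ((z + β 0) / (z + α 0) *
      ∏ k ∈ Finset.range n, (1 + z / β (k + 1)) / (1 + z / α (k + 1))).im := by
  rcases lt_trichotomy z.im 0 with hz | hz | hz
  · have h := im_prod_nonneg_s12 hpos hc1 hc2 (z := (starRingEnd ℂ) z) (by simpa using hz) n
    have hconj : ((starRingEnd ℂ) z + β 0) / ((starRingEnd ℂ) z + α 0) *
        ∏ k ∈ Finset.range n,
          (1 + (starRingEnd ℂ) z / β (k + 1)) / (1 + (starRingEnd ℂ) z / α (k + 1)) =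
        (starRingEnd ℂ) ((z + β 0) / (z + α 0) *
          ∏ k ∈ Finset.range n, (1 + z / β (k + 1)) / (1 + z / α (k + 1))) := by
      simp [map_prod]
    rw [hconj, conj_im] at h
    exact mul_nonneg_of_nonpos_of_nonpos hz.le (by linarith)
  · simp [hz]
  · exact mul_nonneg hz.le (im_prod_nonneg_s12 hpos hc1 hc2 hz n)

theorem stmt12 (C : ℝ) (β α : ℕ → ℝ) (hC : 0 ≤ C)
    -- the chain 0 ≤ β₀ < α₀ < β₁ < α₁ < β₂ < α₂ < ⋯ :
    (h0 : 0 ≤ β 0)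
    (hc1 : ∀ ν, β ν < α ν)
    (hc2 : ∀ ν, α ν < β (ν + 1))
    -- summability of Σ_{ν≥1} (1/α_ν + 1/β_ν) :
    (hsum : Summable fun ν : ℕ => (α (ν + 1))⁻¹ + (β (ν + 1))⁻¹) :
    (∀ z ∈ SDom,
      Multipliable (fun ν : ℕ => (1 + z / (β (ν + 1) : ℂ)) / (1 + z / (α (ν + 1) : ℂ)))) ∧
    IsSFun (fun z =>
      (C : ℂ) * (z + (β 0 : ℂ)) / (z + (α 0 : ℂ)) *
        ∏' ν : ℕ, (1 + z / (β (ν + 1) : ℂ)) / (1 + z / (α (ν + 1) : ℂ))) := by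
  have hpos : ∀ ν, 0 < α ν := fun ν => by
    induction ν with
    | zero => exact h0.trans_lt (hc1 0)
    | succ n ih => exact (ih.trans (hc2 n)).trans (hc1 _)
  have hposβ : ∀ ν, 0 < β (ν + 1) := fun ν => (hpos ν).trans (hc2 ν)
  have hprod := hasProdLocallyUniformlyOn_slitPlane (fun ν => hpos (ν + 1)) hposβ hsum
  have hlim : ∀ z ∈ slitPlane, Tendsto (fun n => (C : ℂ) * ((z + β 0) / (z + α 0) *
      ∏ k ∈ Finset.range n, (1 + z / β (k + 1)) / (1 + z / α (k + 1)))) atTop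
      (𝓝 ((C : ℂ) * (z + (β 0 : ℂ)) / (z + (α 0 : ℂ)) *
        ∏' ν : ℕ, (1 + z / (β (ν + 1) : ℂ)) / (1 + z / (α (ν + 1) : ℂ)))) := fun z hz => by
    rw [mul_div_assoc, mul_assoc]
    exact ((hprod.hasProd hz).tendsto_prod_nat.const_mul _).const_mul _
  unfold IsSFun
  rw [SDom_eq_slitPlane]
  refine ⟨fun z hz => (hprod.hasProd hz).multipliable, ?_, fun z hz => ?_, fun x hx => ?_⟩
  · refine DifferentiableOn.mul (DifferentiableOn.div (by fun_prop) (by fun_prop)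
      fun z hz => add_ofReal_ne_zero_of_mem_slitPlane hz (hpos 0).le) ?_
    refine TendstoLocallyUniformlyOn.differentiableOn hprod (Eventually.of_forall fun s => ?_)
      isOpen_slitPlane
    refine DifferentiableOn.fun_finsetProd fun n _ => DifferentiableOn.div (by fun_prop)
      (by fun_prop) fun z hz => one_add_div_ofReal_ne_zero hz (hpos (n + 1))
  · refine ge_of_tendsto' (((continuous_im.tendsto _).comp (hlim z hz)).const_mul z.im) fun n => ?_
    rw [Function.comp_apply, im_ofReal_mul, mul_left_comm]
    exact mul_nonneg hC (im_mul_im_prod_nonneg hpos hc1 hc2 z n)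
  · have hclosed : IsClosed {w : ℂ | w.im = 0 ∧ 0 ≤ w.re} :=
      (isClosed_eq continuous_im continuous_const).inter
        (isClosed_le continuous_const continuous_re)
    refine hclosed.mem_of_tendsto (hlim x (ofReal_mem_slitPlane.mpr hx))
      (Eventually.of_forall fun n => ?_)
    have hreal : (C : ℂ) * (((x : ℂ) + β 0) / (x + α 0) *
        ∏ k ∈ Finset.range n, (1 + (x : ℂ) / β (k + 1)) / (1 + x / α (k + 1))) =
        ((C * ((x + β 0) / (x + α 0) *
          ∏ k ∈ Finset.range n, (1 + x / β (k + 1)) / (1 + x / α (k + 1))) : ℝ) : ℂ) := by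
      push_cast
      rfl
    rw [hreal]
    refine ⟨ofReal_im _, ?_⟩
    rw [ofReal_re]
    have h1 := hpos 0
    refine mul_nonneg hC (mul_nonneg (by positivity) (Finset.prod_nonneg fun k _ => ?_))
    have h2 := hpos (k + 1)
    have h3 := hposβ k
    positivity
end

section
/- Let F be a function of Form (I) or of Form (II) (with the parameters nondegenerate so that F is not identically equal to a constant C nor to z ↦ C·z; for Form (I) it suffices that at least one interlacing pair β⁺_1 < α⁺_1 is present, and for Form (II) that C > 0). Then for every nonzero integer p the function z ↦ z^p · F(z) does not map the upper half-plane ℂ₊ = {z : Im z > 0} into its closure: there exists z with Im z > 0 and Im(z^p · F(z)) < 0. -/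
open Complex

/-- Index type for a family which is finite (of cardinality `N`) or countably
infinite (`N = ⊤`). -/
def Idx (N : ℕ∞) : Type := {ν : ℕ // (ν : ℕ∞) < N}

/-- `F` agrees on the slit plane with the function of Form (I) with data
`C, Np, Nm, αp, βp, αm, βm`: the interlacing chain
`0 < ⋯ < 1/α⁻₂ < 1/β⁻₁ < 1/α⁻₁ < β⁺₁ < α⁺₁ < β⁺₂ < α⁺₂ < ⋯` holds among the
present indices, reciprocals are summable, and
`F z = C · ∏ (1 + z/β⁺ν)/(1 + z/α⁺ν) · ∏ (1 + z⁻¹/β⁻ν)/(1 + z⁻¹/α⁻ν)`. -/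
def FormIEq (F : ℂ → ℂ) (C : ℝ) (Np Nm : ℕ∞) (αp βp αm βm : ℕ → ℝ) : Prop :=
  0 < C ∧
  (∀ ν : ℕ, (ν : ℕ∞) < Np → 0 < βp ν ∧ βp ν < αp ν) ∧
  (∀ ν : ℕ, ((ν : ℕ∞) + 1) < Np → αp ν < βp (ν + 1)) ∧
  (∀ ν : ℕ, (ν : ℕ∞) < Nm → 0 < βm ν ∧ 0 < αm ν ∧ (βm ν)⁻¹ < (αm ν)⁻¹) ∧
  (∀ ν : ℕ, ((ν : ℕ∞) + 1) < Nm → (αm (ν + 1))⁻¹ < (βm ν)⁻¹) ∧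
  (0 < Np → 0 < Nm → (αm 0)⁻¹ < βp 0) ∧
  Summable (fun ν : Idx Np => (αp ν.1)⁻¹ + (βp ν.1)⁻¹) ∧
  Summable (fun ν : Idx Nm => (αm ν.1)⁻¹ + (βm ν.1)⁻¹) ∧
  ∀ z ∈ SDom,
    Multipliable (fun ν : Idx Np => (1 + z / (βp ν.1 : ℂ)) / (1 + z / (αp ν.1 : ℂ))) ∧
    Multipliable (fun ν : Idx Nm => (1 + z⁻¹ / (βm ν.1 : ℂ)) / (1 + z⁻¹ / (αm ν.1 : ℂ))) ∧
    F z = (C : ℂ) * (∏' ν : Idx Np, (1 + z / (βp ν.1 : ℂ)) / (1 + z / (αp ν.1 : ℂ))) *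
            (∏' ν : Idx Nm, (1 + z⁻¹ / (βm ν.1 : ℂ)) / (1 + z⁻¹ / (αm ν.1 : ℂ)))

/-- `F` is of Form (I). -/
def IsFormI (F : ℂ → ℂ) : Prop :=
  ∃ C Np Nm αp βp αm βm, FormIEq F C Np Nm αp βp αm βm

/-- `F` agrees on the slit plane with the function of Form (II) with data
`C, β₀, α₀, N, β, α`: we have `0 ≤ β₀ < α₀ < β₁ < α₁ < ⋯` among the present
indices, reciprocals are summable, and
`F z = C · (z + β₀)/(z + α₀) · ∏ (1 + z/βν)/(1 + z/αν)`. -/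
def FormIIEq (F : ℂ → ℂ) (C β₀ α₀ : ℝ) (N : ℕ∞) (β α : ℕ → ℝ) : Prop :=
  0 ≤ C ∧ 0 ≤ β₀ ∧ β₀ < α₀ ∧
  (0 < N → α₀ < β 0) ∧
  (∀ ν : ℕ, (ν : ℕ∞) < N → β ν < α ν) ∧
  (∀ ν : ℕ, ((ν : ℕ∞) + 1) < N → α ν < β (ν + 1)) ∧
  Summable (fun ν : Idx N => (α ν.1)⁻¹ + (β ν.1)⁻¹) ∧
  ∀ z ∈ SDom,
    Multipliable (fun ν : Idx N => (1 + z / (β ν.1 : ℂ)) / (1 + z / (α ν.1 : ℂ))) ∧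
    F z = (C : ℂ) * (z + (β₀ : ℂ)) / (z + (α₀ : ℂ)) *
      ∏' ν : Idx N, (1 + z / (β ν.1 : ℂ)) / (1 + z / (α ν.1 : ℂ))

/-- `F` is of Form (II). -/
def IsFormII (F : ℂ → ℂ) : Prop :=
  ∃ C β₀ α₀ N β α, FormIIEq F C β₀ α₀ N β α

/-- The argument of a point of the open upper half-plane, written through `arctan` so that its
monotonicity along horizontal lines is immediate. -/
noncomputable def upperArg (z : ℂ) : ℝ := Real.pi / 2 - Real.arctan (z.re / z.im)

theorem upperArg_pos (z : ℂ) : 0 < upperArg z :=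
  sub_pos.2 (Real.arctan_lt_pi_div_two _)

theorem upperArg_lt_pi (z : ℂ) : upperArg z < Real.pi := by
  have := Real.neg_pi_div_two_lt_arctan (z.re / z.im)
  unfold upperArg
  linarith

theorem upperArg_add_ofReal_strictAnti {z : ℂ} (hz : 0 < z.im) :
    StrictAnti fun t : ℝ => upperArg (z + t) := by
  intro s t hst
  simp only [upperArg, add_re, add_im, ofReal_re, ofReal_im, add_zero]
  gcongr

theorem eq_norm_mul_exp_upperArg {z : ℂ} (hz : 0 < z.im) :
    z = ‖z‖ * exp (upperArg z * I) := by
  have hn : ‖z‖ = z.im * √(1 + (z.re / z.im) ^ 2) := by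
    rw [Complex.norm_eq_sqrt_sq_add_sq, ← Real.sqrt_sq hz.le, ← Real.sqrt_mul (sq_nonneg _),
      Real.sqrt_sq hz.le]
    congr 1
    field_simp
    ring
  have hs : √(1 + (z.re / z.im) ^ 2) ≠ 0 := by positivity
  have hy := hz.ne'
  apply Complex.ext
  · rw [re_ofReal_mul, exp_ofReal_mul_I_re, upperArg, Real.cos_pi_div_two_sub, Real.sin_arctan, hn]
    field_simp
  · rw [im_ofReal_mul, exp_ofReal_mul_I_im, upperArg, Real.sin_pi_div_two_sub, Real.cos_arctan, hn]
    field_simp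

theorem prod_norm_mul_exp {ι : Type*} (s : Finset ι) (f : ι → ℂ) (A : ι → ℝ)
    (h : ∀ i, f i = ‖f i‖ * exp (A i * I)) :
    ∏ i ∈ s, f i = ‖∏ i ∈ s, f i‖ * exp ((∑ i ∈ s, A i : ℝ) * I) := by
  conv_lhs => rw [Finset.prod_congr rfl fun i _ => h i]
  rw [Finset.prod_mul_distrib, ← exp_sum, norm_prod]
  push_cast
  rw [Finset.sum_mul]

theorem exists_arg_mem_Icc_of_hasProd {ι : Type*} {f : ι → ℂ} {A : ι → ℝ} {G : ℂ} {x y : ℝ}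
    (h : ∀ i, f i = ‖f i‖ * exp (A i * I)) (hf : HasProd f G) (hG : G ≠ 0)
    (hA : ∀ᶠ s : Finset ι in Filter.atTop, ∑ i ∈ s, A i ∈ Set.Icc x y) :
    ∃ t ∈ Set.Icc x y, G = ‖G‖ * exp (t * I) := by
  have hK : IsClosed ((fun t : ℝ => exp (t * I)) '' Set.Icc x y) :=
    (isCompact_Icc.image (by fun_prop)).isClosed
  have hn : (‖G‖ : ℂ) ≠ 0 := by simpa using hG
  have hf' : Filter.Tendsto (fun s : Finset ι => ∏ i ∈ s, f i) Filter.atTop (nhds G) := hf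
  have hlim : Filter.Tendsto (fun s : Finset ι => (∏ i ∈ s, f i) / (‖∏ i ∈ s, f i‖ : ℂ))
      Filter.atTop (nhds (G / ‖G‖)) :=
    hf'.div (continuous_ofReal.continuousAt.tendsto.comp hf'.norm) hn
  obtain ⟨t, ht, hGt⟩ := hK.mem_of_tendsto hlim (by
    filter_upwards [hA, hf'.eventually_ne hG] with s hs hs0
    refine ⟨_, hs, ?_⟩
    have h0 : (‖∏ i ∈ s, f i‖ : ℂ) ≠ 0 := by simpa only [ofReal_ne_zero, norm_ne_zero_iff] using hs0
    rw [eq_div_iff h0, mul_comm]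
    exact (prod_norm_mul_exp s f A h).symm)
  refine ⟨t, ht, ?_⟩
  simp only at hGt
  rw [hGt]
  field_simp

theorem linear_frac_eq_norm_mul_exp {z : ℂ} (hz : 0 < z.im) {c : ℝ} (hc : 0 < c) (b a : ℝ) :
    c * (z + b) / (z + a) = ‖c * (z + b) / (z + a)‖ *
      exp ((upperArg (z + b) - upperArg (z + a) : ℝ) * I) := by
  have hb : 0 < (z + b).im := by simpa using hz
  have ha : 0 < (z + a).im := by simpa using hz
  conv_lhs => rw [eq_norm_mul_exp_upperArg hb, eq_norm_mul_exp_upperArg ha]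
  rw [norm_div, norm_mul, norm_real, Real.norm_of_nonneg hc.le, ofReal_sub, sub_mul, exp_sub]
  push_cast
  ring

/-- An antitone function varies over disjoint subintervals of `[L, M]` by at most its variation
over `[L, M]`. -/
theorem sum_sub_le_of_disjoint {ι : Type*} {φ : ℝ → ℝ} (hφ : Antitone φ) {b a : ι → ℝ}
    (hba : ∀ i, b i < a i) (hdis : ∀ i j, i ≠ j → a i ≤ b j ∨ a j ≤ b i) (s : Finset ι) {L M : ℝ}
    (hLM : L ≤ M) (hL : ∀ i ∈ s, L ≤ b i) (hM : ∀ i ∈ s, a i ≤ M) :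
    ∑ i ∈ s, (φ (b i) - φ (a i)) ≤ φ L - φ M := by
  classical
  induction s using Finset.induction_on_max_value a generalizing M with
  | empty => simpa using hφ hLM
  | insert i s hi hmax ih =>
    rw [Finset.sum_insert hi]
    have h1 := ih (M := b i) (hL i (by simp)) (fun j hj => hL j (by simp [hj])) fun j hj => by
      rcases hdis i j (by rintro rfl; exact hi hj) with h | h
      · have := hmax j hj
        have := hba j
        linarith
      · exact h
    have := hφ (hM i (by simp))
    linarith

theorem sum_sub_le_of_gap {ι : Type*} {φ : ℝ → ℝ} (hφ : Antitone φ) (hφ0 : ∀ t, 0 ≤ φ t)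
    {b a : ι → ℝ} (hb : ∀ i, 0 ≤ b i)
    (hba : ∀ i, b i < a i) (hdis : ∀ i j, i ≠ j → a i ≤ b j ∨ a j ≤ b i) {u v : ℝ}
    (hu : 0 ≤ u) (huv : ∀ i, a i ≤ u ∨ v ≤ b i) (s : Finset ι) :
    ∑ i ∈ s, (φ (b i) - φ (a i)) ≤ φ 0 - φ u + φ v := by
  classical
  rw [← Finset.sum_filter_add_sum_filter_not s (fun i => a i ≤ u)]
  have h1 := sum_sub_le_of_disjoint hφ hba hdis (s.filter fun i => a i ≤ u) hu
    (fun i _ => hb i) (fun i hi => (Finset.mem_filter.1 hi).2)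
  obtain ⟨M, hM⟩ := ((s.filter fun i => ¬ a i ≤ u).finite_toSet.image a).bddAbove
  have h2 := sum_sub_le_of_disjoint hφ hba hdis (s.filter fun i => ¬ a i ≤ u)
    (le_max_left v M)
    (fun i hi => (huv i).resolve_left (Finset.mem_filter.1 hi).2)
    (fun i hi => (hM (Set.mem_image_of_mem a hi)).trans (le_max_right v M))
  have := hφ0 (max v M)
  linarith

/-- A convergent product of factors `c (z + b) / (z + a)` with disjoint intervals `[b, a]`, all of
them off a gap `(u, v)`, has an argument pinched between explicit bounds. -/
theorem exists_arg_of_interlacing {ι : Type*} {b a c : ι → ℝ} (hb : ∀ i, 0 ≤ b i)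
    (hba : ∀ i, b i < a i) (hdis : ∀ i j, i ≠ j → a i ≤ b j ∨ a j ≤ b i) (hc : ∀ i, 0 < c i)
    {u v : ℝ} (hu : 0 ≤ u) (huv : ∀ i, a i ≤ u ∨ v ≤ b i) (i₀ : ι) {z G : ℂ} (hz : 0 < z.im)
    (hG : G ≠ 0) (hprod : HasProd (fun i => c i * (z + b i) / (z + a i)) G) :
    ∃ t : ℝ, upperArg (z + b i₀) - upperArg (z + a i₀) ≤ t ∧
      t ≤ upperArg z - upperArg (z + u) + upperArg (z + v) ∧ G = ‖G‖ * exp (t * I) := by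
  have hφ := (upperArg_add_ofReal_strictAnti hz).antitone
  obtain ⟨t, ht, hGt⟩ := exists_arg_mem_Icc_of_hasProd
    (x := upperArg (z + b i₀) - upperArg (z + a i₀))
    (y := upperArg z - upperArg (z + u) + upperArg (z + v))
    (fun i => linear_frac_eq_norm_mul_exp hz (hc i) (b i) (a i)) hprod hG (by
      filter_upwards [Filter.eventually_ge_atTop {i₀}] with s hs
      constructor
      · exact Finset.single_le_sum (f := fun i => upperArg (z + b i) - upperArg (z + a i))
          (fun i _ => sub_nonneg.2 (hφ (hba i).le)) (Finset.singleton_subset_iff.1 hs)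
      · simpa using sum_sub_le_of_gap hφ (fun t => (upperArg_pos _).le) hb hba hdis hu huv s)
  exact ⟨t, ht.1, ht.2, hGt⟩

theorem exists_zpow_mul_im_neg {ι : Type*} {b a c : ι → ℝ} (hb : ∀ i, 0 ≤ b i)
    (hba : ∀ i, b i < a i) (hdis : ∀ i j, i ≠ j → a i ≤ b j ∨ a j ≤ b i) (hc : ∀ i, 0 < c i)
    {u v : ℝ} (hu : 0 ≤ u) (hlt : u < v) (huv : ∀ i, a i ≤ u ∨ v ≤ b i) (i₀ : ι) {G : ℂ → ℂ}
    (hG : ∀ z : ℂ, 0 < z.im → G z ≠ 0)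
    (hprod : ∀ z : ℂ, 0 < z.im → HasProd (fun i => c i * (z + b i) / (z + a i)) (G z))
    {p : ℤ} (hp : p ≠ 0) : ∃ z : ℂ, 0 < z.im ∧ (z ^ p * G z).im < 0 := by
  have key : ∀ z : ℂ, 0 < z.im → ∃ t : ℝ, upperArg (z + b i₀) - upperArg (z + a i₀) ≤ t ∧ 0 < t ∧
      t < upperArg z ∧ (z ^ p * G z).im = ‖z‖ ^ p * ‖G z‖ * Real.sin (p * upperArg z + t) := by
    intro z hz
    obtain ⟨t, ht1, ht2, hGt⟩ :=
      exists_arg_of_interlacing hb hba hdis hc hu huv i₀ hz (hG z hz) (hprod z hz)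
    have hφ := upperArg_add_ofReal_strictAnti hz
    have h1 := hφ (hba i₀)
    have h2 := hφ hlt
    simp only at h1 h2
    refine ⟨t, ht1, by linarith, by linarith, ?_⟩
    have : z ^ p * G z = (‖z‖ ^ p * ‖G z‖ : ℝ) * exp ((p * upperArg z + t : ℝ) * I) := by
      conv_lhs => rw [hGt, eq_norm_mul_exp_upperArg hz]
      rw [mul_zpow, ← exp_int_mul]
      push_cast
      rw [add_mul, exp_add, ← eq_norm_mul_exp_upperArg hz]
      ring_nf
    rw [this, im_ofReal_mul, exp_ofReal_mul_I_im]
  have finish : ∀ z : ℂ, 0 < z.im → ∀ x : ℝ, x < 0 →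
      (z ^ p * G z).im = ‖z‖ ^ p * ‖G z‖ * x → ∃ z : ℂ, 0 < z.im ∧ (z ^ p * G z).im < 0 := by
    intro z hz x hx h
    have hz0 : z ≠ 0 := by rintro rfl; simp at hz
    refine ⟨z, hz, ?_⟩
    rw [h]
    exact mul_neg_of_pos_of_neg
      (mul_pos (zpow_pos (norm_pos_iff.2 hz0) p) (norm_pos_iff.2 (hG z hz))) hx
  have hcases : p = 1 ∨ p = -1 ∨ 2 ≤ |p| := by rw [le_abs]; omega
  rcases hcases with rfl | rfl | hp2
  · set ε := (a i₀ - b i₀) / 2 with hε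
    have hε0 : 0 < ε := by have := hba i₀; linarith
    have hz : 0 < (⟨-a i₀, ε⟩ : ℂ).im := hε0
    obtain ⟨t, ht1, ht0, ht2, him⟩ := key ⟨-a i₀, ε⟩ hz
    refine finish _ hz _ ?_ him
    have hquarter : ∀ r : ℝ, ε < r → Real.pi / 4 < Real.arctan (r / ε) := fun r hr => by
      rw [← Real.arctan_one]
      exact Real.arctan_strictMono ((one_lt_div hε0).2 hr)
    have h1 := hquarter (a i₀) (by have := hb i₀; have := hba i₀; linarith)
    have h2 := hquarter (a i₀ - b i₀) (by linarith)
    have e0 : upperArg ⟨-a i₀, ε⟩ = Real.pi / 2 + Real.arctan (a i₀ / ε) := by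
      simp [upperArg, neg_div, Real.arctan_neg]
    have e1 : upperArg (⟨-a i₀, ε⟩ + b i₀) =
        Real.pi / 2 + Real.arctan ((a i₀ - b i₀) / ε) := by
      have : (-a i₀ + b i₀) / ε = -((a i₀ - b i₀) / ε) := by ring
      simp [upperArg, this, Real.arctan_neg]
    have e2 : upperArg (⟨-a i₀, ε⟩ + a i₀) = Real.pi / 2 := by simp [upperArg]
    have h3 := upperArg_lt_pi ⟨-a i₀, ε⟩
    have hpi := Real.pi_pos
    rw [← Real.sin_sub_two_pi]
    push_cast
    apply Real.sin_neg_of_neg_of_neg_pi_lt <;> linarith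
  · obtain ⟨t, ht1, ht0, ht2, him⟩ := key I (by simp)
    refine finish I (by simp) _ ?_ him
    have := upperArg_lt_pi I
    push_cast
    apply Real.sin_neg_of_neg_of_neg_pi_lt <;> linarith
  · have hq : (2 : ℝ) ≤ |(p : ℝ)| := by exact_mod_cast hp2
    set θ := Real.pi / |(p : ℝ)| with hθ
    have hθ0 : 0 < θ := by have := Real.pi_pos; positivity
    have hθπ : θ < Real.pi := by
      have := Real.pi_pos
      rw [hθ, div_lt_iff₀ (by linarith)]
      nlinarith
    have hz : 0 < (exp (θ * I)).im := by
      rw [exp_ofReal_mul_I_im]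
      exact Real.sin_pos_of_pos_of_lt_pi hθ0 hθπ
    have harg : upperArg (exp (θ * I)) = θ := by
      rw [upperArg, exp_ofReal_mul_I_re, exp_ofReal_mul_I_im, ← Real.sin_pi_div_two_sub,
        ← Real.cos_pi_div_two_sub θ, ← Real.tan_eq_sin_div_cos, Real.arctan_tan] <;> linarith
    obtain ⟨t, ht1, ht0, ht2, him⟩ := key _ hz
    rw [harg] at ht2 him
    refine finish _ hz _ ?_ him
    have hsin : 0 < Real.sin t := Real.sin_pos_of_pos_of_lt_pi ht0 (ht2.trans hθπ)
    rcases le_or_gt 0 (p : ℝ) with h | h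
    · have : (p : ℝ) * θ = Real.pi := by
        rw [abs_of_nonneg h] at hθ hq
        rw [hθ]
        field_simp
      rw [this, add_comm, Real.sin_add_pi]
      linarith
    · have : (p : ℝ) * θ = -Real.pi := by
        have : (p : ℝ) ≠ 0 := h.ne
        rw [abs_of_neg h] at hθ hq
        rw [hθ]
        field_simp
      rw [this, add_comm, ← sub_eq_add_neg, Real.sin_sub_pi]
      linarith

theorem abs_im_le_norm_mul_norm_one_add_mul (w : ℂ) (t : ℝ) : |w.im| ≤ ‖w‖ * ‖1 + w * t‖ := by
  have h := abs_im_le_norm (starRingEnd ℂ w * (1 + w * t))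
  rw [norm_mul, norm_conj] at h
  have e : (starRingEnd ℂ w * (1 + w * t)).im = -w.im := by
    simp
    ring
  rwa [e, abs_neg] at h

theorem one_add_div_ne_zero_s13 {w : ℂ} (hw : w.im ≠ 0) (t : ℝ) : 1 + w / t ≠ 0 := by
  intro h
  have := abs_im_le_norm_mul_norm_one_add_mul w t⁻¹
  rw [ofReal_inv, ← div_eq_mul_inv, h, norm_zero, mul_zero] at this
  exact hw (abs_nonpos_iff.1 this)

theorem tprod_one_add_div_ne_zero_s13 {ι : Type*} {w : ℂ} (hw : w.im ≠ 0) {β α : ι → ℝ}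
    (hβ : ∀ i, 0 < β i) (hα : ∀ i, 0 < α i) (hsum : Summable fun i => (α i)⁻¹ + (β i)⁻¹) :
    ∏' i, (1 + w / (β i : ℂ)) / (1 + w / (α i : ℂ)) ≠ 0 := by
  have hfac : ∀ i, (1 + w / (β i : ℂ)) / (1 + w / (α i : ℂ)) =
      1 + w * ((β i)⁻¹ - (α i)⁻¹ : ℝ) / (1 + w / (α i : ℂ)) := fun i => by
    have := one_add_div_ne_zero_s13 hw (α i)
    rw [div_eq_iff this, add_mul, div_mul_cancel₀ _ this]
    push_cast
    ring
  simp_rw [hfac]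
  refine tprod_one_add_ne_zero_of_summable (fun i => ?_) ?_
  · rw [← hfac i]
    exact div_ne_zero (one_add_div_ne_zero_s13 hw _) (one_add_div_ne_zero_s13 hw _)
  · refine Summable.of_nonneg_of_le (fun i => norm_nonneg _) (fun i => ?_)
      (hsum.mul_left (‖w‖ ^ 2 / |w.im|))
    have h1 := abs_im_le_norm_mul_norm_one_add_mul w (α i)⁻¹
    rw [ofReal_inv, ← div_eq_mul_inv] at h1
    have h2 : 0 < |w.im| := abs_pos.2 hw
    have h3 : 0 < ‖1 + w / (α i : ℂ)‖ := norm_pos_iff.2 (one_add_div_ne_zero_s13 hw _)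
    have h4 := inv_pos.2 (hβ i)
    have h5 := inv_pos.2 (hα i)
    have h6 : |(β i)⁻¹ - (α i)⁻¹| ≤ (α i)⁻¹ + (β i)⁻¹ := by
      rw [abs_le]
      constructor <;> linarith
    rw [norm_div, norm_mul, norm_real, Real.norm_eq_abs, div_mul_eq_mul_div, div_le_div_iff₀ h3 h2]
    calc ‖w‖ * |(β i)⁻¹ - (α i)⁻¹| * |w.im|
        ≤ ‖w‖ * ((α i)⁻¹ + (β i)⁻¹) * (‖w‖ * ‖1 + w / (α i : ℂ)‖) := by
          gcongr
      _ = _ := by ring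

theorem lt_of_interlacing {N : ℕ∞} {x y : ℕ → ℝ} (hxy : ∀ ν : ℕ, (ν : ℕ∞) < N → x ν < y ν)
    (hyx : ∀ ν : ℕ, ((ν : ℕ∞) + 1) < N → y ν < x (ν + 1)) {i j : ℕ} (hij : i < j)
    (hj : (j : ℕ∞) < N) : y i < x j := by
  induction j, hij using Nat.le_induction with
  | base => exact hyx i (by exact_mod_cast hj)
  | succ j hij ih =>
    have hj' : (j : ℕ∞) < N := lt_of_le_of_lt (by exact_mod_cast j.le_succ) hj
    exact ((ih hj').trans (hxy j hj')).trans (hyx j (by exact_mod_cast hj))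

theorem le_or_le_of_interlacing {N : ℕ∞} {x y : ℕ → ℝ} (hxy : ∀ ν : ℕ, (ν : ℕ∞) < N → x ν < y ν)
    (hyx : ∀ ν : ℕ, ((ν : ℕ∞) + 1) < N → y ν < x (ν + 1)) (i j : Idx N) (hij : i ≠ j) :
    y i.1 ≤ x j.1 ∨ y j.1 ≤ x i.1 := by
  rcases lt_or_gt_of_ne (fun h => hij (Subtype.ext h) : i.1 ≠ j.1) with h | h
  · exact .inl (lt_of_interlacing hxy hyx h j.2).le
  · exact .inr (lt_of_interlacing hxy hyx h i.2).le

theorem zero_le_of_interlacing {N : ℕ∞} {x y : ℕ → ℝ}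
    (hxy : ∀ ν : ℕ, (ν : ℕ∞) < N → x ν < y ν)
    (hyx : ∀ ν : ℕ, ((ν : ℕ∞) + 1) < N → y ν < x (ν + 1)) (i : Idx N) : x 0 ≤ x i.1 := by
  rcases Nat.eq_zero_or_pos i.1 with h | h
  · rw [h]
  · exact ((hxy 0 (zero_le.trans_lt i.2)).trans (lt_of_interlacing hxy hyx h i.2)).le

theorem mem_SDom_of_im_pos {z : ℂ} (hz : 0 < z.im) : z ∈ SDom := fun h => hz.ne' h.1

theorem exists_zpow_mul_im_neg_of_ofReal_mul {F G : ℂ → ℂ} {C : ℝ} (hC : 0 < C)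
    (hF : ∀ z : ℂ, 0 < z.im → F z = C * G z) {p : ℤ}
    (h : ∃ z : ℂ, 0 < z.im ∧ (z ^ p * G z).im < 0) :
    ∃ z : ℂ, 0 < z.im ∧ (z ^ p * F z).im < 0 := by
  obtain ⟨z, hz, hneg⟩ := h
  refine ⟨z, hz, ?_⟩
  rw [hF z hz, mul_left_comm, im_ofReal_mul]
  exact mul_neg_of_pos_of_neg hC hneg

theorem one_add_div_div_one_add_div (z : ℂ) {β α : ℝ} (hβ : 0 < β) (hα : 0 < α) :
    (1 + z / (β : ℂ)) / (1 + z / (α : ℂ)) = (α / β : ℝ) * (z + β) / (z + α) := by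
  have h1 : (β : ℂ) ≠ 0 := ofReal_ne_zero.2 hβ.ne'
  have h2 : (α : ℂ) ≠ 0 := ofReal_ne_zero.2 hα.ne'
  rw [one_add_div h1, one_add_div h2, div_div_div_eq, add_comm z, add_comm z]
  push_cast
  rw [div_mul_eq_mul_div, div_div, mul_comm (α : ℂ)]

theorem one_add_inv_div_div_one_add_inv_div {z : ℂ} (hz : z ≠ 0) (β α : ℝ) :
    (1 + z⁻¹ / (β : ℂ)) / (1 + z⁻¹ / (α : ℂ)) =
      (1 : ℝ) * (z + (β⁻¹ : ℝ)) / (z + (α⁻¹ : ℝ)) := by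
  have h : ∀ t : ℂ, 1 + z⁻¹ / t = z⁻¹ * (z + t⁻¹) := fun t => by field_simp
  rw [h, h, mul_div_mul_left _ _ (inv_ne_zero hz)]
  push_cast
  ring

theorem FormIEq.exists_zpow_mul_im_neg {F : ℂ → ℂ} {C : ℝ} {Np Nm : ℕ∞} {αp βp αm βm : ℕ → ℝ}
    (h : FormIEq F C Np Nm αp βp αm βm) (hNp : 0 < Np) {p : ℤ} (hp : p ≠ 0) :
    ∃ z : ℂ, 0 < z.im ∧ (z ^ p * F z).im < 0 := by
  obtain ⟨hC, hp1, hp2, hm1, hm2, hpm, hsp, hsm, hF⟩ := h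
  have hp1' : ∀ ν : ℕ, (ν : ℕ∞) < Np → βp ν < αp ν := fun ν hν => (hp1 ν hν).2
  have hm1' : ∀ ν : ℕ, (ν : ℕ∞) < Nm → -(αm ν)⁻¹ < -(βm ν)⁻¹ :=
    fun ν hν => neg_lt_neg (hm1 ν hν).2.2
  have hm2' : ∀ ν : ℕ, ((ν : ℕ∞) + 1) < Nm → -(βm ν)⁻¹ < -(αm (ν + 1))⁻¹ :=
    fun ν hν => neg_lt_neg (hm2 ν hν)
  have hp0 : ∀ i : Idx Np, βp 0 ≤ βp i.1 := zero_le_of_interlacing hp1' hp2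
  have hm0 : ∀ i : Idx Nm, (αm i.1)⁻¹ ≤ (αm 0)⁻¹ := fun i =>
    neg_le_neg_iff.1 (zero_le_of_interlacing (x := fun ν => -(αm ν)⁻¹) hm1' hm2' i)
  have hgap : ∃ u, 0 ≤ u ∧ u < βp 0 ∧ ∀ i : Idx Nm, (αm i.1)⁻¹ ≤ u := by
    rcases eq_zero_or_pos Nm with h0 | h0
    · refine ⟨0, le_rfl, (hp1 0 hNp).1, fun i => absurd i.2 (by simp [h0])⟩
    · exact ⟨(αm 0)⁻¹, (inv_pos.2 (hm1 0 h0).2.1).le, hpm hNp h0, hm0⟩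
  obtain ⟨u, hu, hlt, hmu⟩ := hgap
  refine exists_zpow_mul_im_neg_of_ofReal_mul hC (fun z hz =>
    ((hF z (mem_SDom_of_im_pos hz)).2.2).trans (mul_assoc _ _ _)) <|
    _root_.exists_zpow_mul_im_neg (ι := Idx Np ⊕ Idx Nm)
      (b := Sum.elim (fun i => βp i.1) fun i => (βm i.1)⁻¹)
      (a := Sum.elim (fun i => αp i.1) fun i => (αm i.1)⁻¹)
      (c := Sum.elim (fun i => αp i.1 / βp i.1) fun _ => 1)
      ?_ ?_ ?_ ?_ hu hlt ?_ (Sum.inl ⟨0, hNp⟩) ?_ ?_ hp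
  · rintro (i | i)
    · exact (hp1 _ i.2).1.le
    · exact (inv_pos.2 (hm1 _ i.2).1).le
  · rintro (i | i)
    · exact hp1' _ i.2
    · exact (hm1 _ i.2).2.2
  · rintro (i | i) (j | j) hij
    · exact le_or_le_of_interlacing hp1' hp2 i j (by rintro rfl; exact hij rfl)
    · exact .inr (((hmu j).trans hlt.le).trans (hp0 i))
    · exact .inl (((hmu i).trans hlt.le).trans (hp0 j))
    · have := le_or_le_of_interlacing (x := fun ν => -(αm ν)⁻¹) (y := fun ν => -(βm ν)⁻¹)
        hm1' hm2' i j (by rintro rfl; exact hij rfl)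
      simp only [neg_le_neg_iff] at this
      exact this.symm
  · rintro (i | i)
    · exact div_pos ((hp1 _ i.2).1.trans (hp1' _ i.2)) (hp1 _ i.2).1
    · exact one_pos
  · rintro (i | i)
    · exact .inr (hp0 i)
    · exact .inl (hmu i)
  · intro z hz
    have hzinv : z⁻¹.im ≠ 0 := by
      have hz0 : z ≠ 0 := by rintro rfl; simp at hz
      rw [inv_im]
      exact div_ne_zero (neg_ne_zero.2 hz.ne') (by simpa using hz0)
    exact mul_ne_zero
      (tprod_one_add_div_ne_zero_s13 hz.ne' (fun i => (hp1 _ i.2).1)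
        (fun i => (hp1 _ i.2).1.trans (hp1' _ i.2)) hsp)
      (tprod_one_add_div_ne_zero_s13 hzinv (fun i => (hm1 _ i.2).1) (fun i => (hm1 _ i.2).2.1) hsm)
  · intro z hz
    have hz0 : z ≠ 0 := by rintro rfl; simp at hz
    obtain ⟨h1, h2, -⟩ := hF z (mem_SDom_of_im_pos hz)
    refine HasProd.sum ?_ ?_
    · convert h1.hasProd using 1
      funext i
      exact (one_add_div_div_one_add_div z (hp1 _ i.2).1
        ((hp1 _ i.2).1.trans (hp1' _ i.2))).symm
    · convert h2.hasProd using 1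
      funext i
      exact (one_add_inv_div_div_one_add_inv_div hz0 _ _).symm

theorem FormIIEq.exists_zpow_mul_im_neg {F : ℂ → ℂ} {C β₀ α₀ : ℝ} {N : ℕ∞} {β α : ℕ → ℝ}
    (h : FormIIEq F C β₀ α₀ N β α) (hC : 0 < C) {p : ℤ} (hp : p ≠ 0) :
    ∃ z : ℂ, 0 < z.im ∧ (z ^ p * F z).im < 0 := by
  obtain ⟨-, hβ₀, hβα₀, h0, h1, h2, hs, hF⟩ := h
  have hα₀ : 0 < α₀ := hβ₀.trans_lt hβα₀
  have hgap : ∃ v, α₀ < v ∧ ∀ i : Idx N, v ≤ β i.1 := by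
    rcases eq_zero_or_pos N with hN | hN
    · exact ⟨α₀ + 1, by linarith, fun i => absurd i.2 (by simp [hN])⟩
    · exact ⟨β 0, h0 hN, zero_le_of_interlacing h1 h2⟩
  obtain ⟨v, hlt, hv⟩ := hgap
  have hβ : ∀ i : Idx N, 0 < β i.1 := fun i => (hα₀.trans hlt).trans_le (hv i)
  have hα : ∀ i : Idx N, 0 < α i.1 := fun i => (hβ i).trans (h1 _ i.2)
  have hne : ∀ (z : ℂ) (t : ℝ), 0 < z.im → z + t ≠ 0 := fun z t hz h => by
    have := congrArg im h
    simp [hz.ne'] at this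
  refine exists_zpow_mul_im_neg_of_ofReal_mul hC
    (G := fun z => (z + β₀) / (z + α₀) *
      ∏' i : Idx N, (1 + z / (β i.1 : ℂ)) / (1 + z / (α i.1 : ℂ)))
    (fun z hz => ((hF z (mem_SDom_of_im_pos hz)).2).trans (by ring)) <|
    _root_.exists_zpow_mul_im_neg (ι := Unit ⊕ Idx N)
      (b := Sum.elim (fun _ => β₀) fun i => β i.1)
      (a := Sum.elim (fun _ => α₀) fun i => α i.1)
      (c := Sum.elim (fun _ => 1) fun i => α i.1 / β i.1)
      ?_ ?_ ?_ ?_ hα₀.le hlt ?_ (Sum.inl ()) ?_ ?_ hp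
  · rintro (i | i)
    · exact hβ₀
    · exact (hβ i).le
  · rintro (i | i)
    · exact hβα₀
    · exact h1 _ i.2
  · rintro (i | i) (j | j) hij
    · exact absurd rfl hij
    · exact .inl (hlt.le.trans (hv j))
    · exact .inr (hlt.le.trans (hv i))
    · exact le_or_le_of_interlacing h1 h2 i j (by rintro rfl; exact hij rfl)
  · rintro (i | i)
    · exact one_pos
    · exact div_pos (hα i) (hβ i)
  · rintro (i | i)
    · exact .inl le_rfl
    · exact .inr (hv i)
  · intro z hz
    exact mul_ne_zero (div_ne_zero (hne z _ hz) (hne z _ hz))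
      (tprod_one_add_div_ne_zero_s13 hz.ne' hβ hα hs)
  · intro z hz
    refine HasProd.sum ?_ ?_
    · convert hasProd_fintype (fun _ : Unit => (z + β₀) / (z + α₀)) using 1
      · funext i
        simp
      · simp
    · convert ((hF z (mem_SDom_of_im_pos hz)).1).hasProd using 1
      funext i
      exact (one_add_div_div_one_add_div z (hβ i) (hα i)).symm

theorem stmt13 (F : ℂ → ℂ)
    (h : (∃ C Np Nm αp βp αm βm, FormIEq F C Np Nm αp βp αm βm ∧ 0 < Np) ∨
         (∃ C β₀ α₀ N β α, FormIIEq F C β₀ α₀ N β α ∧ 0 < C)) :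
    ∀ p : ℤ, p ≠ 0 → ∃ z : ℂ, 0 < z.im ∧ (z ^ p * F z).im < 0 := by
  intro p hp
  rcases h with ⟨C, Np, Nm, αp, βp, αm, βm, h, hNp⟩ | ⟨C, β₀, α₀, N, β, α, h, hC⟩
  · exact h.exists_zpow_mul_im_neg hNp hp
  · exact h.exists_zpow_mul_im_neg hC hp
end
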